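/- If H is a finite-dimensional Hopf algebra over a field of positive characteristic, then exp₀(H) < ∞. -/

import Mathlib

open TensorProduct

noncomputable section

variable (k H : Type*) [CommRing k] [Ring H] [Bialgebra k H]

/-- Convolution product `f * g = m ∘ (f ⊗ g) ∘ Δ` on linear endomorphisms. -/
def conv (f g : Module.End k H) : Module.End k H :=
  LinearMap.mul' k H ∘ₗ TensorProduct.map f g ∘ₗ Coalgebra.comul

/-- The convolution unit `u ∘ ε`. -/
def convOne : Module.End k H := (Algebra.linearMap k H) ∘ₗ Coalgebra.counit

/-- `convSeq F n = m_n ∘ (F 0 ⊗ F 1 ⊗ ⋯ ⊗ F (n-1)) ∘ Δ_n` (as an iterated convolution). -/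
def convSeq : (ℕ → Module.End k H) → ℕ → Module.End k H
  | _, 0 => convOne k H
  | F, n + 1 => conv k H (F 0) (convSeq (fun j => F (j + 1)) n)

/-- The `n`-th Sweedler power `[n] = m_n ∘ Δ_n` as a linear endomorphism. -/
def sweedlerPow (n : ℕ) : Module.End k H := convSeq k H (fun _ => LinearMap.id) n

/-- The twisted Sweedler power `m_n ∘ (id ⊗ T ⊗ T² ⊗ ⋯ ⊗ T^(n-1)) ∘ Δ_n`. -/
def twistPow (T : Module.End k H) (n : ℕ) : Module.End k H :=
  convSeq k H (fun j => T ^ j) n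

/-- `exp₀(H)`: the least `n ≥ 1` with `[n] = u ∘ ε`, in `ℕ ∪ {∞}` (`sInf ∅ = ∞`). -/
def exp0 : ℕ∞ :=
  sInf {e : ℕ∞ | ∃ n : ℕ, e = n ∧ 0 < n ∧ sweedlerPow k H n = convOne k H}

/-- The `T`-twisted exponent: least `n ≥ 1` with
`m_n ∘ (id ⊗ T ⊗ ⋯ ⊗ T^(n-1)) ∘ Δ_n = u ∘ ε`, in `ℕ ∪ {∞}`.  For `T = S⁻²` this is
`exp(H)` and for `T = S^(2i)` this is the twisted exponent `exp_{2i}(H)`. -/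
def expAt (T : Module.End k H) : ℕ∞ :=
  sInf {e : ℕ∞ | ∃ n : ℕ, e = n ∧ 0 < n ∧ twistPow k H T n = convOne k H}

namespace Xp
set_option linter.unusedSectionVars false
set_option linter.unusedVariables false

/-- linearity as a plain predicate -/
@[fun_prop] def Lin (F : Type*) {M N : Type*} [CommSemiring F] [AddCommMonoid M] [AddCommMonoid N] [Module F M] [Module F N]
    (f : M → N) : Prop := (∀ x y, f (x + y) = f x + f y) ∧ (∀ (c : F) x, f (c • x) = c • f x)

section basic
variable {F A M N P Q : Type*} [CommSemiring F] [AddCommMonoid A] [AddCommMonoid M] [AddCommMonoid N]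
  [AddCommMonoid P] [AddCommMonoid Q] [Module F A] [Module F M] [Module F N] [Module F P] [Module F Q]

def Lin.toLin {f : M → N} (h : Lin F f) : M →ₗ[F] N := ⟨⟨f, h.1⟩, h.2⟩

theorem Lin.sum {f : M → N} (h : Lin F f) {ι : Type*} (s : Finset ι) (g : ι → M) :
    f (∑ i ∈ s, g i) = ∑ i ∈ s, f (g i) := map_sum h.toLin g s

@[fun_prop] theorem Lin.id : Lin F (fun x : M => x) := ⟨fun _ _ => rfl, fun _ _ => rfl⟩
@[fun_prop] theorem Lin.comp' {f : N → P} (hf : Lin F f) {g : M → N} (hg : Lin F g) : Lin F (fun x => f (g x)) :=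
  ⟨fun x y => by beta_reduce; rw [hg.1, hf.1], fun c x => by beta_reduce; rw [hg.2, hf.2]⟩
@[fun_prop] theorem Lin.map (f : M →ₗ[F] N) {g : P → M} (hg : Lin F g) : Lin F (fun x => f (g x)) :=
  ⟨fun x y => by beta_reduce; rw [hg.1, map_add], fun c x => by beta_reduce; rw [hg.2, map_smul]⟩
@[fun_prop] theorem Lin.fsum {ι : Type*} (s : Finset ι) {g : ι → M → N} (hg : ∀ i, Lin F (g i)) :
    Lin F (fun x => ∑ i ∈ s, g i x) :=
  ⟨fun x y => by simp only [(hg _).1, Finset.sum_add_distrib], fun c x => by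
    simp only [(hg _).2, Finset.smul_sum]⟩
@[fun_prop] theorem Lin.tl (m : N) {g : P → M} (hg : Lin F g) : Lin F (fun x => g x ⊗ₜ[F] m) :=
  ⟨fun x y => by beta_reduce; rw [hg.1, TensorProduct.add_tmul], fun c x => by beta_reduce; rw [hg.2, TensorProduct.smul_tmul']⟩
@[fun_prop] theorem Lin.tr (m : N) {g : P → M} (hg : Lin F g) : Lin F (fun x => m ⊗ₜ[F] g x) :=
  ⟨fun x y => by beta_reduce; rw [hg.1, TensorProduct.tmul_add], fun c x => by beta_reduce; rw [hg.2, TensorProduct.tmul_smul]⟩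
@[fun_prop] theorem Lin.smulr {g : P → F} (hg : Lin F g) (m : M) : Lin F (fun x => g x • m) :=
  ⟨fun x y => by beta_reduce; rw [hg.1, add_smul], fun c x => by beta_reduce; rw [hg.2, smul_eq_mul, mul_smul]⟩
@[fun_prop] theorem Lin.smull (c : F) {g : P → M} (hg : Lin F g) : Lin F (fun x => c • g x) :=
  ⟨fun x y => by beta_reduce; rw [hg.1, smul_add], fun d x => by beta_reduce; rw [hg.2, smul_comm]⟩
end basic
section alg
variable {F B P C: Type*} [CommSemiring F] [Semiring B] [Algebra F B] [AddCommMonoid P] [Module F P]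
  [Semiring C] [Algebra F C]
@[fun_prop] theorem Lin.ml (m : B) {g : P → B} (hg : Lin F g) : Lin F (fun x => m * g x) :=
  ⟨fun x y => by beta_reduce; rw [hg.1, mul_add], fun c x => by beta_reduce; rw [hg.2, mul_smul_comm]⟩
@[fun_prop] theorem Lin.mr (m : B) {g : P → B} (hg : Lin F g) : Lin F (fun x => g x * m) :=
  ⟨fun x y => by beta_reduce; rw [hg.1, add_mul], fun c x => by beta_reduce; rw [hg.2, smul_mul_assoc]⟩
@[fun_prop] theorem Lin.amap (f : B →ₐ[F] C) {g : P → B} (hg : Lin F g) : Lin F (fun x => f (g x)) :=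
  ⟨fun x y => by beta_reduce; rw [hg.1, map_add], fun c x => by beta_reduce; rw [hg.2, map_smul]⟩
end alg

section sw
variable {F A M N : Type*} [Field F] [Ring A] [HopfAlgebra F A] [FiniteDimensional F A]
  [AddCommMonoid M] [Module F M] [AddCommMonoid N] [Module F N]

variable (F A) in
abbrev bas : Module.Basis (Fin (Module.finrank F A)) F A := Module.finBasis F A

/-- left legs of the comultiplication -/
def Dl (a : Fin (Module.finrank F A)) : A →ₗ[F] A :=
  (TensorProduct.rid F A).toLinearMap ∘ₗ (LinearMap.lTensor A ((bas F A).coord a)) ∘ₗ Coalgebra.comul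

theorem tens_expand (t : A ⊗[F] A) : t = ∑ a, ((TensorProduct.rid F A).toLinearMap
    (LinearMap.lTensor A ((bas F A).coord a) t)) ⊗ₜ[F] (bas F A a) := by
  induction t with
  | zero => simp
  | add x y hx hy =>
    simp only [map_add, TensorProduct.add_tmul, Finset.sum_add_distrib]
    rw [← hx, ← hy]
  | tmul x y =>
    simp only [LinearMap.lTensor_tmul, LinearEquiv.coe_coe, TensorProduct.rid_tmul,
      TensorProduct.smul_tmul, ← TensorProduct.tmul_sum]
    congr 1
    simp [Module.Basis.sum_repr]

theorem comul_eq (h : A) : Coalgebra.comul (R := F) h = ∑ a, (Dl (F := F) a h) ⊗ₜ[F] (bas F A a) :=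
  tens_expand _

variable (F) in
/-- Sweedler sum -/
def sw (f : A → A → M) (h : A) : M := ∑ a, f (Dl (F := F) a h) (bas F A a)

theorem sw_eq_lift (f : A →ₗ[F] A →ₗ[F] M) (h : A) :
    sw F (fun x y => f x y) h = TensorProduct.lift f (Coalgebra.comul (R := F) h) := by
  rw [comul_eq]; simp [sw]

variable (F) in
structure Lin2 {A B M : Type*} [AddCommMonoid A] [Module F A] [AddCommMonoid B] [Module F B]
   [AddCommMonoid M] [Module F M] (f : A → B → M) : Prop where
  l : ∀ y, Lin F (fun x => f x y)
  r : ∀ x, Lin F (fun y => f x y)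

variable (F) in
structure Lin3 {A B C M : Type*} [AddCommMonoid A] [Module F A] [AddCommMonoid B] [Module F B]
   [AddCommMonoid C] [Module F C]
   [AddCommMonoid M] [Module F M] (f : A → B → C → M) : Prop where
  l : ∀ y z, Lin F (fun x => f x y z)
  m : ∀ x z, Lin F (fun y => f x y z)
  r : ∀ x y, Lin F (fun z => f x y z)

def Lin2.toLin {A B M : Type*} [AddCommMonoid A] [Module F A] [AddCommMonoid B] [Module F B]
   [AddCommMonoid M] [Module F M] {f : A → B → M} (h : Lin2 F f) : A →ₗ[F] B →ₗ[F] M :=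
  LinearMap.mk₂ F f (fun x y z => (h.l z).1 x y) (fun c x z => (h.l z).2 c x)
    (fun x => (h.r x).1) (fun c x => (h.r x).2 c)

def Lin3.toLin {A B C M : Type*} [AddCommMonoid A] [Module F A] [AddCommMonoid B] [Module F B]
   [AddCommMonoid C] [Module F C]
   [AddCommMonoid M] [Module F M] {f : A → B → C → M} (h : Lin3 F f) : A →ₗ[F] B →ₗ[F] C →ₗ[F] M :=
  LinearMap.mk₂ F (fun x y => (⟨⟨f x y, (h.r x y).1⟩, (h.r x y).2⟩ : C →ₗ[F] M))
    (fun x y z => LinearMap.ext fun c => (h.l z c).1 x y) (fun c x z => LinearMap.ext fun d => (h.l z d).2 c x)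
    (fun x y z => LinearMap.ext fun c => (h.m x c).1 y z) (fun c x z => LinearMap.ext fun d => (h.m x d).2 c z)

@[simp] theorem Lin2.toLin_apply {A B M : Type*} [AddCommMonoid A] [Module F A] [AddCommMonoid B] [Module F B]
   [AddCommMonoid M] [Module F M] {f : A → B → M} (h : Lin2 F f) (x y) : h.toLin x y = f x y := rfl
@[simp] theorem Lin3.toLin_apply {A B C M : Type*} [AddCommMonoid A] [Module F A] [AddCommMonoid B] [Module F B]
   [AddCommMonoid C] [Module F C]
   [AddCommMonoid M] [Module F M] {f : A → B → C → M} (h : Lin3 F f) (x y z) : h.toLin x y z = f x y z := rfl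

/-- the Sweedler sum of a bilinear function is linear. -/
@[fun_prop] theorem Lin.sw {P : Type*} [AddCommMonoid P] [Module F P] {f : P → A → A → M} (hf : ∀ x y, Lin F (fun p => f p x y)) (h : A) :
    Lin F (fun p => sw F (f p) h) := Lin.fsum _ fun _ => hf _ _
@[fun_prop] theorem Lin.sw' {P : Type*} [AddCommMonoid P] [Module F P] {f : A → A → M} (hf : ∀ y, Lin F (fun p => f p y)) {g : P → A}
   (hg : Lin F g) :
    Lin F (fun p => Xp.sw F f (g p)) := Lin.fsum _ fun a => Lin.comp' (hf _) (Lin.map (Dl a) hg)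

theorem sw_eq_of {f : A → A → M} (hf : Lin2 F f) (h : A) :
    sw F f h = TensorProduct.lift hf.toLin (Coalgebra.comul (R := F) h) := sw_eq_lift hf.toLin h

theorem sw_tmul (h : A) : sw F (fun x y => x ⊗ₜ[F] y) h = Coalgebra.comul (R := F) h := (comul_eq h).symm

theorem map_sw (g : M → N) (hg : Lin F g) (f : A → A → M) (h : A) :
    g (sw F f h) = sw F (fun x y => g (f x y)) h := hg.sum _ _

theorem sw_congr {f g : A → A → M} (h : A) (H : ∀ x y, f x y = g x y) : sw F f h = sw F g h := by
  simp only [sw, H]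

theorem sw_sum {ι : Type*} (s : Finset ι) (f : ι → A → A → M) (h : A) :
    ∑ i ∈ s, sw F (f i) h = sw F (fun x y => ∑ i ∈ s, f i x y) h := by
  simp only [sw]; rw [Finset.sum_comm]

theorem sw_swap {f : A → A → A → A → M} (h h' : A) :
   sw F (fun x y => sw F (fun z w => f x y z w) h') h = sw F (fun z w => sw F (fun x y => f x y z w) h) h' := by
  simp only [sw]; rw [Finset.sum_comm]

theorem sw_assoc {f : A → A → A → M} (hf : Lin3 F f) (h : A) :
    sw F (fun x z => sw F (fun x y => f x y z) x) h = sw F (fun x y => sw F (fun y z => f x y z) y) h := by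
  have h0 := Coalgebra.coassoc_apply (R := F) h
  rw [comul_eq] at h0
  simp only [map_sum, LinearMap.rTensor_tmul, LinearMap.lTensor_tmul, comul_eq, TensorProduct.sum_tmul,
    TensorProduct.tmul_sum, TensorProduct.assoc_tmul] at h0
  have h1 := congrArg (TensorProduct.lift (TensorProduct.uncurry (RingHom.id F) A A M ∘ₗ hf.toLin)) h0
  simpa [sw] using h1

theorem sw_counit_left {f : A → M} (hf : Lin F f) (h : A) :
    sw F (fun x y => Coalgebra.counit (R := F) x • f y) h = f h := by
  have h0 := Coalgebra.rTensor_counit_comul (R := F) h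
  rw [comul_eq] at h0
  have h1 := congrArg (fun t => hf.toLin (TensorProduct.lid F A t)) h0
  simp only [map_sum, LinearMap.rTensor_tmul, TensorProduct.lid_tmul, map_smul, one_smul] at h1
  exact h1
theorem sw_counit_right {f : A → M} (hf : Lin F f) (h : A) :
    sw F (fun x y => Coalgebra.counit (R := F) y • f x) h = f h := by
  have h0 := Coalgebra.lTensor_counit_comul (R := F) h
  rw [comul_eq] at h0
  have h1 := congrArg (fun t => hf.toLin (TensorProduct.rid F A t)) h0
  simp only [map_sum, LinearMap.lTensor_tmul, TensorProduct.rid_tmul, map_smul, one_smul] at h1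
  exact h1

theorem sw_Sm {f : A → M} (hf : Lin F f) (h : A) :
    sw F (fun x y => f (HopfAlgebra.antipode F x * y)) h = Coalgebra.counit (R := F) h • f 1 := by
  have h0 := HopfAlgebra.mul_antipode_rTensor_comul_apply (R := F) h
  rw [comul_eq] at h0
  have h1 := congrArg (fun t => hf.toLin t) h0
  simp only [map_sum, LinearMap.rTensor_tmul, LinearMap.mul'_apply, Algebra.algebraMap_eq_smul_one, map_smul] at h1
  exact h1
theorem sw_mS {f : A → M} (hf : Lin F f) (h : A) :
    sw F (fun x y => f (x * HopfAlgebra.antipode F y)) h = Coalgebra.counit (R := F) h • f 1 := by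
  have h0 := HopfAlgebra.mul_antipode_lTensor_comul_apply (R := F) h
  rw [comul_eq] at h0
  have h1 := congrArg (fun t => hf.toLin t) h0
  simp only [map_sum, LinearMap.lTensor_tmul, LinearMap.mul'_apply, Algebra.algebraMap_eq_smul_one, map_smul] at h1
  exact h1

theorem sw_one {f : A → A → M} (hf : Lin2 F f) : sw F f 1 = f 1 1 := by
  rw [sw_eq_of hf]; simp [Algebra.TensorProduct.one_def]

theorem sw_mul {f : A → A → M} (hf : Lin2 F f) (h g : A) :
    sw F f (h * g) = sw F (fun x y => sw F (fun z w => f (x * z) (y * w)) g) h := by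
  rw [sw_eq_of hf, Bialgebra.comul_mul, comul_eq h, comul_eq g, Finset.sum_mul_sum]
  simp [sw]


@[fun_prop] theorem Lin.counit {P : Type*} [AddCommMonoid P] [Module F P] {g : P → A} (hg : Lin F g) :
  Lin F (fun x => Coalgebra.counit (R := F) (g x)) := Lin.map _ hg
@[fun_prop] theorem Lin.antipode {P : Type*} [AddCommMonoid P] [Module F P] {g : P → A} (hg : Lin F g) :
  Lin F (fun x => HopfAlgebra.antipode F (g x)) := Lin.map _ hg

/-- contraction of neighbouring legs, the pair `(2,3)` -/
theorem sw_Sm23 {f : A → A → M} (hf : Lin2 F f) (h : A) :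
    sw F (fun x y => sw F (fun y z => f x (HopfAlgebra.antipode F y * z)) y) h = f h 1 := by
  rw [← sw_counit_right (hf.l 1) h]
  exact sw_congr h fun x y => sw_Sm (hf.r x) y
theorem sw_mS23 {f : A → A → M} (hf : Lin2 F f) (h : A) :
    sw F (fun x y => sw F (fun y z => f x (y * HopfAlgebra.antipode F z)) y) h = f h 1 := by
  rw [← sw_counit_right (hf.l 1) h]
  exact sw_congr h fun x y => sw_mS (hf.r x) y
/-- contraction of neighbouring legs, the pair `(1,2)` -/
theorem sw_Sm12 {f : A → A → M} (hf : Lin2 F f) (h : A) :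
    sw F (fun x z => sw F (fun x y => f (HopfAlgebra.antipode F x * y) z) x) h = f 1 h := by
  rw [← sw_counit_left (hf.r 1) h]
  exact sw_congr h fun x y => sw_Sm (hf.l y) x
theorem sw_mS12 {f : A → A → M} (hf : Lin2 F f) (h : A) :
    sw F (fun x z => sw F (fun x y => f (x * HopfAlgebra.antipode F y) z) x) h = f 1 h := by
  rw [← sw_counit_left (hf.r 1) h]
  exact sw_congr h fun x y => sw_mS (hf.l y) x

theorem conv_sw {B : Type*} [Ring B] [Algebra F B] (f g : WithConv (A →ₗ[F] B)) (h : A) :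
    (f * g) h = sw F (fun x y => f x * g y) h := by
  rw [LinearMap.convMul_apply, comul_eq]
  simp [sw]

theorem comul_antipode (h : A) : Coalgebra.comul (R := F) (HopfAlgebra.antipode F h) =
    sw F (fun x y => HopfAlgebra.antipode F y ⊗ₜ[F] HopfAlgebra.antipode F x) h := by
  let G : A →ₗ[F] A ⊗[F] A := (TensorProduct.map (HopfAlgebra.antipode F) (HopfAlgebra.antipode F)) ∘ₗ
    (TensorProduct.comm F A A).toLinearMap ∘ₗ Coalgebra.comul
  have hG : ∀ h, G h = sw F (fun x y => HopfAlgebra.antipode F y ⊗ₜ[F] HopfAlgebra.antipode F x) h := by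
    intro h
    simp only [G, LinearMap.comp_apply, comul_eq, map_sum]
    simp [sw]
  have h1 : WithConv.toConv G * WithConv.toConv (Coalgebra.comul (R := F) (A := A)) = 1 := by
    ext h
    rw [conv_sw]
    have : ∀ x y : A, (WithConv.toConv G) x * (WithConv.toConv (Coalgebra.comul (R := F) (A := A))) y
       = sw F (fun x1 x2 => sw F (fun y1 y2 => (HopfAlgebra.antipode F x2 * y1) ⊗ₜ[F]
         (HopfAlgebra.antipode F x1 * y2)) y) x := by
      intro x y
      change G x * Coalgebra.comul (R := F) y = _
      rw [hG, comul_eq y, sw, Finset.sum_mul_sum]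
      simp [sw]
    rw [sw_congr h this]
    rw [sw_assoc (f := fun x1 x2 z => sw F (fun y1 y2 => (HopfAlgebra.antipode F x2 * y1) ⊗ₜ[F]
         (HopfAlgebra.antipode F x1 * y2)) z) ⟨by fun_prop, by fun_prop, by fun_prop⟩]
    have : ∀ x y : A, sw F (fun x2 z => sw F (fun y1 y2 => (HopfAlgebra.antipode F x2 * y1) ⊗ₜ[F]
         (HopfAlgebra.antipode F x * y2)) z) y = 1 ⊗ₜ[F] (HopfAlgebra.antipode F x * y) := by
      intro x y
      rw [← sw_assoc (f := fun x2 y1 y2 => (HopfAlgebra.antipode F x2 * y1) ⊗ₜ[F]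
         (HopfAlgebra.antipode F x * y2)) ⟨by fun_prop, by fun_prop, by fun_prop⟩]
      exact sw_Sm12 (f := fun a b => a ⊗ₜ[F] (HopfAlgebra.antipode F x * b)) ⟨by fun_prop, by fun_prop⟩ y
    rw [sw_congr h this, sw_Sm (f := fun a => (1 : A) ⊗ₜ[F] a) (by fun_prop)]
    rw [LinearMap.convOne_apply, Algebra.algebraMap_eq_smul_one, Algebra.TensorProduct.one_def]
  have h2 := left_inv_eq_right_inv h1 LinearMap.comul_right_inv
  rw [← hG]
  exact (congrArg (fun t : WithConv (A →ₗ[F] A ⊗[F] A) => t h) h2).symm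

theorem sw_antipode {f : A → A → M} (hf : Lin2 F f) (h : A) : sw F f (HopfAlgebra.antipode F h) =
    sw F (fun x y => f (HopfAlgebra.antipode F y) (HopfAlgebra.antipode F x)) h := by
  rw [sw_eq_of hf, comul_antipode, sw, map_sum]
  rfl

end sw
end Xp

namespace Xp
set_option linter.unusedSectionVars false
set_option linter.unusedVariables false

/-- A representation of the double, packaged as an algebra map and an L-operator. -/
structure Obj (F A E : Type*) [Field F] [Ring A] [HopfAlgebra F A] [FiniteDimensional F A] [Ring E] [Algebra F E] where
  ι : Type
  fin : Fintype ι
  l : ι → A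
  e : ι → E
  π : A →ₐ[F] E
  ax1 : ∑ i, sw F (fun x y => x ⊗ₜ[F] (y ⊗ₜ[F] e i)) (l i) = ∑ i, ∑ j, l i ⊗ₜ[F] (l j ⊗ₜ[F] (e j * e i))
  ax2 : ∑ i, Coalgebra.counit (R := F) (l i) • e i = 1
  ax3 : ∀ h, ∑ i, sw F (fun x y => (x * l i) ⊗ₜ[F] (π y * e i)) h =
    ∑ i, sw F (fun x y => (l i * y) ⊗ₜ[F] (e i * π x)) h

attribute [instance] Obj.fin

namespace Obj
variable {F A E M : Type*} [Field F] [Ring A] [HopfAlgebra F A] [FiniteDimensional F A] [Ring E] [Algebra F E]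
  [AddCommMonoid M] [Module F M]
variable (O : Obj F A E)

local notation "S" => HopfAlgebra.antipode F (A := A)
local notation "ε" => Coalgebra.counit (R := F) (A := A)

theorem L1 {f : A → A → E → M} (hf : Lin3 F f) :
    ∑ i, sw F (fun x y => f x y (O.e i)) (O.l i) = ∑ i, ∑ j, f (O.l i) (O.l j) (O.e j * O.e i) := by
  have h1 := congrArg (TensorProduct.lift (TensorProduct.uncurry (RingHom.id F) A E M ∘ₗ hf.toLin)) O.ax1
  simpa [sw] using h1

theorem L2 {f : E → M} (hf : Lin F f) : ∑ i, ε (O.l i) • f (O.e i) = f 1 := by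
  have h1 := congrArg hf.toLin O.ax2
  simp only [map_sum, map_smul] at h1
  exact h1

theorem L3 {f : A → E → M} (hf : Lin2 F f) (h : A) : ∑ i, sw F (fun x y => f (x * O.l i) (O.π y * O.e i)) h =
    ∑ i, sw F (fun x y => f (O.l i * y) (O.e i * O.π x)) h := by
  have h1 := congrArg (TensorProduct.lift hf.toLin) (O.ax3 h)
  simpa [sw] using h1

/-- the Drinfeld-type element -/
def w : E := ∑ i, O.π (S (O.l i)) * O.e i

theorem star (h : A) : sw F (fun x y => O.π (S y) * O.w * O.π x) h = ε h • O.w := by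
  have h3 := O.L3 (f := fun x y => O.π (S x) * y) ⟨by fun_prop, by fun_prop⟩ h
  simp only [HopfAlgebra.antipode_mul_antidistrib, map_mul] at h3
  rw [sw_sum, sw_sum] at h3
  have e1 : ∀ x y, O.π (S y) * O.w * O.π x = ∑ i, O.π (S y) * O.π (S (O.l i)) * (O.e i * O.π x) := by
    intro x y
    simp only [w, Finset.mul_sum, Finset.sum_mul, mul_assoc]
  rw [sw_congr h e1, ← h3, ← sw_sum]
  have e2 : ∀ i, sw F (fun x y => O.π (S (O.l i)) * O.π (S x) * (O.π y * O.e i)) h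
      = ε h • (O.π (S (O.l i)) * O.e i) := by
    intro i
    have := sw_Sm (F := F) (f := fun t => O.π (S (O.l i)) * O.π t * O.e i) (by fun_prop) h
    simp only [map_mul, map_one, mul_one] at this
    rw [← this]
    exact sw_congr h fun x y => by simp only [mul_assoc]
  simp only [e2, w, Finset.smul_sum]

theorem w_mul (h : A) : O.w * O.π h = O.π (S (S h)) * O.w := by
  have h1 := sw_mS23 (F := F) (f := fun x t => O.π (S t) * O.w * O.π x) ⟨by fun_prop, by fun_prop⟩ h
  rw [HopfAlgebra.antipode_one, map_one, one_mul] at h1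
  rw [← h1, ← sw_assoc (F := F) (f := fun x y z => O.π (S (y * S z)) * O.w * O.π x) ⟨by fun_prop, by fun_prop, by fun_prop⟩]
  have : ∀ x z, sw F (fun x y => O.π (S (y * S z)) * O.w * O.π x) x = ε x • (O.π (S (S z)) * O.w) := by
    intro x z
    have := map_sw (F := F) (fun t => O.π (S (S z)) * t) (by fun_prop) (fun x y => O.π (S y) * O.w * O.π x) x
    rw [star, mul_smul_comm] at this
    rw [this]
    exact sw_congr x fun x y => by simp only [HopfAlgebra.antipode_mul_antidistrib, map_mul, mul_assoc]
  rw [sw_congr h this, sw_counit_left (by fun_prop)]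

theorem w_inv (T : A →ₗ[F] A) (hT : ∀ x, S (S (T x)) = x) : O.w * ∑ j, O.π (T (O.l j)) * O.e j = 1 := by
  have h1 := O.L1 (f := fun x y z => O.π (x * S y) * z) ⟨by fun_prop, by fun_prop, by fun_prop⟩
  have h2 : ∀ i, sw F (fun x y => O.π (x * S y) * O.e i) (O.l i) = ε (O.l i) • O.e i := by
    intro i
    rw [sw_mS (F := F) (f := fun t => O.π t * O.e i) (by fun_prop)]; simp
  simp only [h2] at h1
  rw [O.ax2] at h1
  rw [h1, Finset.mul_sum]
  refine Finset.sum_congr rfl fun j _ => ?_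
  rw [← mul_assoc, O.w_mul, hT, w, Finset.mul_sum, Finset.sum_mul]
  simp only [map_mul, mul_assoc]

/-- evaluation of endomorphisms -/
def ev : (A →ₗ[F] A) →ₗ[F] E where
  toFun g := ∑ i, O.π (g (O.l i)) * O.e i
  map_add' f g := by simp [add_mul, Finset.sum_add_distrib]
  map_smul' c g := by simp [Finset.smul_sum]

variable (F A) in
/-- the operator implementing multiplication by `w` -/
def Bop : Module.End F (A →ₗ[F] A) where
  toFun g := LinearMap.mul' F A ∘ₗ TensorProduct.map (S ∘ₗ S ∘ₗ g) S ∘ₗ Coalgebra.comul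
  map_add' f g := by
    simp only [LinearMap.comp_add, TensorProduct.map_add_left, LinearMap.add_comp]
  map_smul' c g := by
    simp only [LinearMap.comp_smul, TensorProduct.map_smul_left, LinearMap.smul_comp, RingHom.id_apply]

theorem Bop_apply (g : A →ₗ[F] A) (h : A) : Bop F A g h = sw F (fun x y => S (S (g x)) * S y) h := by
  simp only [Bop, LinearMap.coe_mk, AddHom.coe_mk, LinearMap.comp_apply, comul_eq, map_sum]
  simp [sw]

theorem ev_Bop (g : A →ₗ[F] A) : O.ev (Bop F A g) = O.w * O.ev g := by
  have h1 := O.L1 (f := fun x y z => O.π (S (S (g x)) * S y) * z) ⟨by fun_prop, by fun_prop, by fun_prop⟩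
  simp only [ev, LinearMap.coe_mk, AddHom.coe_mk, Finset.mul_sum]
  have : ∀ i, O.w * (O.π (g (O.l i)) * O.e i) = ∑ j, O.π (S (S (g (O.l i))) * S (O.l j)) * (O.e j * O.e i) := by
    intro i
    rw [← mul_assoc, O.w_mul, w, Finset.mul_sum, Finset.sum_mul]
    simp only [map_mul, mul_assoc]
  simp only [this]
  rw [← h1]
  refine Finset.sum_congr rfl fun i _ => ?_
  rw [Bop_apply]
  exact map_sw (fun t => O.π t * O.e i) (by fun_prop) _ _

theorem ev_one : O.ev (Algebra.linearMap F A ∘ₗ Coalgebra.counit) = 1 := by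
  rw [← O.ax2]
  simp [ev, Algebra.algebraMap_eq_smul_one]

theorem ev_pow (n : ℕ) : O.ev ((Bop F A ^ n) (Algebra.linearMap F A ∘ₗ Coalgebra.counit)) = O.w ^ n := by
  induction n with
  | zero => simpa using O.ev_one
  | succ n ih => rw [pow_succ', Module.End.mul_apply, ev_Bop, ih, pow_succ']

theorem aeval_w : Polynomial.aeval O.w (LinearMap.charpoly (Bop F A)) = 0 := by
  have h1 : ∀ f : Polynomial F, O.ev (Polynomial.aeval (Bop F A) f (Algebra.linearMap F A ∘ₗ Coalgebra.counit))
      = Polynomial.aeval O.w f := by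
    intro f
    induction f using Polynomial.induction_on' with
    | add p q hp hq => simp only [map_add, LinearMap.add_apply, hp, hq]
    | monomial n a =>
      rw [Polynomial.aeval_monomial, Polynomial.aeval_monomial, Module.algebraMap_end_eq_smul_id]
      simp only [Module.End.mul_apply, LinearMap.smul_apply, LinearMap.id_apply, map_smul, ev_pow]
      rw [Algebra.smul_def]
  rw [← h1, LinearMap.aeval_self_charpoly]; simp

end Obj
end Xp

namespace Xp
set_option linter.unusedSectionVars false
set_option linter.unusedVariables false
namespace Obj
variable {F A E M : Type*} [Field F] [Ring A] [HopfAlgebra F A] [FiniteDimensional F A] [Ring E] [Algebra F E]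
  [AddCommMonoid M] [Module F M]
variable (O : Obj F A E)

local notation "S" => HopfAlgebra.antipode F (A := A)
local notation "ε" => Coalgebra.counit (R := F) (A := A)

theorem B0 {f : A → E → M} (hf : Lin2 F f) (h : A) : ∑ i, f (O.l i) (O.e i * O.π h) =
    ∑ i, sw F (fun x y => sw F (fun y z => f (x * O.l i * S z) (O.π y * O.e i)) y) h := by
  obtain ⟨hl, hr⟩ := hf
  have e1 : ∀ i, sw F (fun x y => sw F (fun y z => f (x * O.l i * S z) (O.π y * O.e i)) y) h
    = sw F (fun x z => sw F (fun x y => f (x * O.l i * S z) (O.π y * O.e i)) x) h := fun i =>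
    (sw_assoc (F := F) (f := fun x y z => f (x * O.l i * S z) (O.π y * O.e i))
      ⟨by fun_prop, by fun_prop, by fun_prop⟩ h).symm
  simp only [e1]
  rw [sw_sum]
  have e2 : ∀ x z, ∑ i, sw F (fun x y => f (x * O.l i * S z) (O.π y * O.e i)) x =
    ∑ i, sw F (fun x y => f (O.l i * y * S z) (O.e i * O.π x)) x := fun x z =>
     O.L3 (f := fun a b => f (a * S z) b) ⟨by fun_prop, by fun_prop⟩ x
  rw [sw_congr h e2, ← sw_sum]
  refine Finset.sum_congr rfl fun i _ => ?_
  rw [sw_assoc (F := F) (f := fun x y z => f (O.l i * y * S z) (O.e i * O.π x))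
      ⟨by fun_prop, by fun_prop, by fun_prop⟩]
  simp only [mul_assoc (O.l i)]
  rw [sw_mS23 (F := F) (f := fun x t => f (O.l i * t) (O.e i * O.π x)) ⟨by fun_prop, by fun_prop⟩, mul_one]

theorem B1 {f : A → E → M} (hf : Lin2 F f) : ∑ i, f (O.l i) (O.e i * O.w) =
    ∑ i, f (S (S (O.l i))) (O.w * O.e i) := by
  obtain ⟨hl, hr⟩ := hf
  have e1 : ∑ i, f (O.l i) (O.e i * O.w) = ∑ j, ∑ i, f (O.l i) (O.e i * O.π (S (O.l j)) * O.e j) := by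
    rw [Finset.sum_comm]
    refine Finset.sum_congr rfl fun i _ => ?_
    rw [w, Finset.mul_sum, (hr _).sum]
    simp only [mul_assoc]
  rw [e1]
  have e2 : ∀ j, ∑ i, f (O.l i) (O.e i * O.π (S (O.l j)) * O.e j) =
     ∑ i, sw F (fun c d => sw F (fun d b => f (S b * O.l i * S (S c)) (O.π (S d) * (O.e i * O.e j))) d) (O.l j) := by
    intro j
    rw [O.B0 (f := fun a b => f a (b * O.e j)) ⟨by fun_prop, by fun_prop⟩]
    refine Finset.sum_congr rfl fun i _ => ?_
    rw [sw_antipode ⟨by fun_prop, by fun_prop⟩]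
    rw [← sw_assoc (F := F) (f := fun c d b => f (S b * O.l i * S (S c)) (O.π (S d) * (O.e i * O.e j)))
      ⟨by fun_prop, by fun_prop, by fun_prop⟩]
    refine sw_congr _ fun x y => ?_
    rw [sw_antipode ⟨by fun_prop, by fun_prop⟩]
    simp only [mul_assoc]
  simp only [e2]
  rw [← O.L1 (f := fun x0 y0 z0 => sw F (fun c d => sw F (fun d b =>
     f (S b * y0 * S (S c)) (O.π (S d) * z0)) d) x0) ⟨by fun_prop, by fun_prop, by fun_prop⟩]
  have e3 : ∀ i, sw F (fun x0 y0 => sw F (fun c d => sw F (fun d b =>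
     f (S b * y0 * S (S c)) (O.π (S d) * O.e i)) d) x0) (O.l i) =
     sw F (fun x y => f (S (S x)) (O.π (S y) * O.e i)) (O.l i) := by
    intro i
    rw [sw_assoc (F := F) (f := fun c d y0 => sw F (fun d b =>
     f (S b * y0 * S (S c)) (O.π (S d) * O.e i)) d) ⟨by fun_prop, by fun_prop, by fun_prop⟩]
    refine sw_congr _ fun c t => ?_
    rw [sw_assoc (F := F) (f := fun d b y0 => f (S b * y0 * S (S c)) (O.π (S d) * O.e i))
       ⟨by fun_prop, by fun_prop, by fun_prop⟩]
    rw [sw_Sm23 (F := F) (f := fun d t => f (t * S (S c)) (O.π (S d) * O.e i)) ⟨by fun_prop, by fun_prop⟩, one_mul]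
  simp only [e3]
  rw [O.L1 (f := fun x y z => f (S (S x)) (O.π (S y) * z)) ⟨by fun_prop, by fun_prop, by fun_prop⟩]
  refine Finset.sum_congr rfl fun i _ => ?_
  rw [w, Finset.sum_mul, (hr _).sum]
  simp only [mul_assoc]

/-- the R-operator -/
def R : E ⊗[F] E := ∑ i, O.π (O.l i) ⊗ₜ[F] O.e i
def R21 : E ⊗[F] E := ∑ i, O.e i ⊗ₜ[F] O.π (O.l i)

theorem R_comm : O.R * (O.w ⊗ₜ[F] O.w) = (O.w ⊗ₜ[F] O.w) * O.R := by
  rw [R, Finset.sum_mul, Finset.mul_sum]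
  simp only [Algebra.TensorProduct.tmul_mul_tmul, O.w_mul]
  exact O.B1 (f := fun a b => (O.π a * O.w) ⊗ₜ[F] b) ⟨by fun_prop, by fun_prop⟩

/-- tensor square representation -/
def π2 : A →ₐ[F] E ⊗[F] E := (Algebra.TensorProduct.map O.π O.π).comp (Bialgebra.comulAlgHom F A)

theorem pi_two_eq (h : A) : O.π2 h = sw F (fun x y => O.π x ⊗ₜ[F] O.π y) h := by
  simp [π2, comul_eq, sw]

theorem R21_π2 (h : A) : O.R21 * O.π2 h = sw F (fun x y => O.π y ⊗ₜ[F] O.π x) h * O.R21 := by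
  have h3 := O.L3 (f := fun a b => b ⊗ₜ[F] O.π a) ⟨by fun_prop, by fun_prop⟩ h
  rw [pi_two_eq, R21, Finset.sum_mul, Finset.mul_sum]
  simp only [map_mul] at h3
  have e1 : ∀ i, (O.e i ⊗ₜ[F] O.π (O.l i)) * sw F (fun x y => O.π x ⊗ₜ[F] O.π y) h =
     sw F (fun x y => (O.e i * O.π x) ⊗ₜ[F] (O.π (O.l i) * O.π y)) h := fun i =>
      (map_sw (F := F) (fun t => (O.e i ⊗ₜ[F] O.π (O.l i)) * t) (by fun_prop) _ _).trans (by simp only [Algebra.TensorProduct.tmul_mul_tmul])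
  have e2 : ∀ i, sw F (fun x y => O.π y ⊗ₜ[F] O.π x) h * (O.e i ⊗ₜ[F] O.π (O.l i))  =
     sw F (fun x y => (O.π y * O.e i) ⊗ₜ[F] (O.π x * O.π (O.l i))) h := fun i =>
      (map_sw (F := F) (fun t => t * (O.e i ⊗ₜ[F] O.π (O.l i))) (by fun_prop) _ _).trans (by simp only [Algebra.TensorProduct.tmul_mul_tmul])
  simp only [e1, e2, h3]

def Y : E ⊗[F] E := ∑ i, O.π2 (S (O.l i)) * (O.e i ⊗ₜ[F] 1)

theorem pi_op_S (h : A) : sw F (fun x y => O.π y ⊗ₜ[F] O.π x) (S h) = sw F (fun x y => O.π (S x) ⊗ₜ[F] O.π (S y)) h :=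
  sw_antipode ⟨by fun_prop, by fun_prop⟩ h

theorem R21_Y : O.R21 * O.Y = O.w ⊗ₜ[F] 1 := by
  rw [Y, Finset.mul_sum]
  have e1 : ∀ j, O.R21 * (O.π2 (S (O.l j)) * (O.e j ⊗ₜ[F] 1)) = ∑ i, sw F (fun x y =>
      (O.π (S x) * (O.e i * O.e j)) ⊗ₜ[F] (O.π (S y * O.l i))) (O.l j) := by
    intro j
    rw [← mul_assoc, R21_π2, pi_op_S, R21, Finset.mul_sum, Finset.sum_mul]
    refine Finset.sum_congr rfl fun i _ => ?_
    refine (map_sw (F := F) (fun t => t * (O.e i ⊗ₜ[F] O.π (O.l i)) * (O.e j ⊗ₜ[F] 1)) (by fun_prop) _ _).trans ?_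
    simp only [Algebra.TensorProduct.tmul_mul_tmul, map_mul, mul_one, mul_assoc]
  simp only [e1]
  rw [← O.L1 (f := fun x0 y0 z => sw F (fun x y => (O.π (S x) * z) ⊗ₜ[F] (O.π (S y * y0))) x0)
    ⟨by fun_prop, by fun_prop, by fun_prop⟩, w, TensorProduct.sum_tmul]
  refine Finset.sum_congr rfl fun i _ => ?_
  rw [sw_assoc (F := F) (f := fun x y y0 => (O.π (S x) * O.e i) ⊗ₜ[F] (O.π (S y * y0)))
    ⟨by fun_prop, by fun_prop, by fun_prop⟩]
  rw [sw_Sm23 (F := F) (f := fun x t => (O.π (S x) * O.e i) ⊗ₜ[F] (O.π t)) ⟨by fun_prop, by fun_prop⟩, map_one]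

theorem dbl_ax1 : ∑ i : O.ι × O.ι, sw F (fun x y => x ⊗ₜ[F] (y ⊗ₜ[F] (O.e i.1 ⊗ₜ[F] O.e i.2))) (O.l i.1 * O.l i.2)
   = ∑ i : O.ι × O.ι, ∑ j : O.ι × O.ι, (O.l i.1 * O.l i.2) ⊗ₜ[F] ((O.l j.1 * O.l j.2) ⊗ₜ[F]
    ((O.e j.1 ⊗ₜ[F] O.e j.2) * (O.e i.1 ⊗ₜ[F] O.e i.2))) := by
  have e1 : ∀ i i', sw F (fun x y => x ⊗ₜ[F] (y ⊗ₜ[F] (O.e i ⊗ₜ[F] O.e i'))) (O.l i * O.l i') =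
     sw F (fun x y => sw F (fun z w => (x * z) ⊗ₜ[F] ((y * w) ⊗ₜ[F] (O.e i ⊗ₜ[F] O.e i'))) (O.l i')) (O.l i) := by
    intro i i'
    rw [sw_mul ⟨by fun_prop, by fun_prop⟩]
  simp only [Fintype.sum_prod_type, e1]
  simp only [sw_sum]
  have e2 : ∀ i x y, ∑ i', sw F (fun z w => (x * z) ⊗ₜ[F] ((y * w) ⊗ₜ[F] (O.e i ⊗ₜ[F] O.e i'))) (O.l i') =
     ∑ i', ∑ j', (x * O.l i') ⊗ₜ[F] ((y * O.l j') ⊗ₜ[F] (O.e i ⊗ₜ[F] (O.e j' * O.e i'))) := fun i x y =>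
    O.L1 (f := fun z w e => (x * z) ⊗ₜ[F] ((y * w) ⊗ₜ[F] (O.e i ⊗ₜ[F] e))) ⟨by fun_prop, by fun_prop, by fun_prop⟩
  simp only [e2]
  rw [O.L1 (f := fun x y e => ∑ i', ∑ j', (x * O.l i') ⊗ₜ[F] ((y * O.l j') ⊗ₜ[F] (e ⊗ₜ[F] (O.e j' * O.e i'))))
    ⟨by fun_prop, by fun_prop, by fun_prop⟩]
  refine Finset.sum_congr rfl fun i _ => ?_
  rw [Finset.sum_comm]
  simp only [Algebra.TensorProduct.tmul_mul_tmul]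

theorem dbl_ax3 (h : A) : ∑ i : O.ι × O.ι, sw F (fun x y => (x * (O.l i.1 * O.l i.2)) ⊗ₜ[F] (O.π2 y * (O.e i.1 ⊗ₜ[F] O.e i.2))) h =
    ∑ i : O.ι × O.ι, sw F (fun x y => (O.l i.1 * O.l i.2 * y) ⊗ₜ[F] ((O.e i.1 ⊗ₜ[F] O.e i.2) * O.π2 x)) h := by
  simp only [Fintype.sum_prod_type]
  have e1 : ∀ i i', sw F (fun x y => (x * (O.l i * O.l i')) ⊗ₜ[F] (O.π2 y * (O.e i ⊗ₜ[F] O.e i'))) h =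
     sw F (fun x z => sw F (fun x y => (x * O.l i * O.l i') ⊗ₜ[F] ((O.π y * O.e i) ⊗ₜ[F] (O.π z * O.e i'))) x) h := by
    intro i i'
    rw [sw_assoc (F := F) (f := fun x y z => (x * O.l i * O.l i') ⊗ₜ[F] ((O.π y * O.e i) ⊗ₜ[F] (O.π z * O.e i')))
      ⟨by fun_prop, by fun_prop, by fun_prop⟩]
    refine sw_congr _ fun x y => ?_
    rw [pi_two_eq]
    refine (map_sw (F := F) (fun t => (x * (O.l i * O.l i')) ⊗ₜ[F] (t * (O.e i ⊗ₜ[F] O.e i'))) (by fun_prop) _ _).trans ?_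
    simp only [Algebra.TensorProduct.tmul_mul_tmul, mul_assoc]
  have e2 : ∀ i i', sw F (fun x y => (O.l i * O.l i' * y) ⊗ₜ[F] ((O.e i ⊗ₜ[F] O.e i') * O.π2 x)) h =
     sw F (fun x y => sw F (fun y z => (O.l i * (O.l i' * z)) ⊗ₜ[F] ((O.e i * O.π x) ⊗ₜ[F] (O.e i' * O.π y))) y) h := by
    intro i i'
    rw [← sw_assoc (F := F) (f := fun x y z => (O.l i * (O.l i' * z)) ⊗ₜ[F] ((O.e i * O.π x) ⊗ₜ[F] (O.e i' * O.π y)))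
      ⟨by fun_prop, by fun_prop, by fun_prop⟩]
    refine sw_congr _ fun x y => ?_
    rw [pi_two_eq]
    refine (map_sw (F := F) (fun t => (O.l i * O.l i' * y) ⊗ₜ[F] ((O.e i ⊗ₜ[F] O.e i') * t)) (by fun_prop) _ _).trans ?_
    simp only [Algebra.TensorProduct.tmul_mul_tmul, mul_assoc]
  simp only [e1, e2]
  have e3 : ∀ i, ∑ i', sw F (fun x y => sw F (fun y z => (O.l i * (O.l i' * z)) ⊗ₜ[F] ((O.e i * O.π x) ⊗ₜ[F] (O.e i' * O.π y))) y) h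
    = ∑ i', sw F (fun x y => sw F (fun y z => (O.l i * (y * O.l i')) ⊗ₜ[F] ((O.e i * O.π x) ⊗ₜ[F] (O.π z * O.e i'))) y) h := by
    intro i
    rw [sw_sum, sw_sum]
    refine sw_congr _ fun x y => ?_
    exact (O.L3 (f := fun a b => (O.l i * a) ⊗ₜ[F] ((O.e i * O.π x) ⊗ₜ[F] b)) ⟨by fun_prop, by fun_prop⟩ y).symm
  simp only [e3]
  rw [Finset.sum_comm]
  conv_rhs => rw [Finset.sum_comm]
  refine Finset.sum_congr rfl fun i' _ => ?_
  have e4 : ∀ i, sw F (fun x y => sw F (fun y z => (O.l i * (y * O.l i')) ⊗ₜ[F] ((O.e i * O.π x) ⊗ₜ[F] (O.π z * O.e i'))) y) h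
   = sw F (fun x z => sw F (fun x y => (O.l i * y * O.l i') ⊗ₜ[F] ((O.e i * O.π x) ⊗ₜ[F] (O.π z * O.e i'))) x) h := by
    intro i
    rw [sw_assoc (F := F) (f := fun x y z => (O.l i * y * O.l i') ⊗ₜ[F] ((O.e i * O.π x) ⊗ₜ[F] (O.π z * O.e i')))
      ⟨by fun_prop, by fun_prop, by fun_prop⟩]
    simp only [mul_assoc]
  simp only [e4]
  rw [sw_sum, sw_sum]
  refine sw_congr _ fun x z => ?_
  exact O.L3 (f := fun a b => (a * O.l i') ⊗ₜ[F] (b ⊗ₜ[F] (O.π z * O.e i'))) ⟨by fun_prop, by fun_prop⟩ x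

/-- the tensor square of an object -/
def dbl : Obj F A (E ⊗[F] E) where
  ι := O.ι × O.ι
  fin := inferInstance
  l i := O.l i.1 * O.l i.2
  e i := O.e i.1 ⊗ₜ[F] O.e i.2
  π := O.π2
  ax1 := O.dbl_ax1
  ax2 := by
    have h := O.ax2
    simp only [Fintype.sum_prod_type, Bialgebra.counit_mul, ← TensorProduct.smul_tmul_smul]
    simp only [← TensorProduct.tmul_sum, ← TensorProduct.sum_tmul, h, Algebra.TensorProduct.one_def]
  ax3 := O.dbl_ax3

theorem dbl_w : O.dbl.w = ∑ j, O.π2 (S (O.l j)) * O.Y * (1 ⊗ₜ[F] O.e j) := by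
  have : O.dbl.w = ∑ i : O.ι × O.ι, O.π2 (S (O.l i.1 * O.l i.2)) * (O.e i.1 ⊗ₜ[F] O.e i.2) := rfl
  rw [this, Fintype.sum_prod_type, Finset.sum_comm]
  refine Finset.sum_congr rfl fun j _ => ?_
  rw [Y, Finset.mul_sum, Finset.sum_mul]
  refine Finset.sum_congr rfl fun i _ => ?_
  simp only [HopfAlgebra.antipode_mul_antidistrib, map_mul, mul_assoc, Algebra.TensorProduct.tmul_mul_tmul,
   mul_one, one_mul]

theorem comm_R21 : Algebra.TensorProduct.comm F E E O.R21 = O.R := by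
  simp [R, R21]

theorem comm_R : Algebra.TensorProduct.comm F E E O.R = O.R21 := by
  simp [R, R21]

theorem comm_Y : Algebra.TensorProduct.comm F E E O.Y = ∑ j, sw F (fun x y => O.π (S x) ⊗ₜ[F] O.π (S y)) (O.l j) * (1 ⊗ₜ[F] O.e j) := by
  rw [Y, map_sum]
  refine Finset.sum_congr rfl fun j _ => ?_
  rw [map_mul, Algebra.TensorProduct.comm_tmul, pi_two_eq, ← pi_op_S]
  congr 1
  simp [sw]

theorem R_R21_w : O.R * O.R21 * O.dbl.w = O.w ⊗ₜ[F] O.w := by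
  have h1 : O.R21 * O.dbl.w = Algebra.TensorProduct.comm F E E O.Y * (O.w ⊗ₜ[F] 1) := by
    rw [dbl_w, comm_Y, Finset.mul_sum, Finset.sum_mul]
    refine Finset.sum_congr rfl fun j _ => ?_
    rw [← mul_assoc, ← mul_assoc, R21_π2, pi_op_S, mul_assoc _ O.R21, R21_Y]
    simp only [mul_assoc, Algebra.TensorProduct.tmul_mul_tmul, mul_one, one_mul]
  have h2 : O.R * Algebra.TensorProduct.comm F E E O.Y = 1 ⊗ₜ[F] O.w := by
    rw [← O.comm_R21, ← map_mul, R21_Y, Algebra.TensorProduct.comm_tmul]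
  rw [mul_assoc, h1, ← mul_assoc, h2]
  simp only [Algebra.TensorProduct.tmul_mul_tmul, mul_one, one_mul]

/-- slot embeddings -/
def i13 : E ⊗[F] E →ₐ[F] (E ⊗[F] E) ⊗[F] (E ⊗[F] E) :=
  Algebra.TensorProduct.map Algebra.TensorProduct.includeLeft Algebra.TensorProduct.includeLeft
def i14 : E ⊗[F] E →ₐ[F] (E ⊗[F] E) ⊗[F] (E ⊗[F] E) :=
  Algebra.TensorProduct.map Algebra.TensorProduct.includeLeft Algebra.TensorProduct.includeRight
def i23 : E ⊗[F] E →ₐ[F] (E ⊗[F] E) ⊗[F] (E ⊗[F] E) :=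
  Algebra.TensorProduct.map Algebra.TensorProduct.includeRight Algebra.TensorProduct.includeLeft
def i24 : E ⊗[F] E →ₐ[F] (E ⊗[F] E) ⊗[F] (E ⊗[F] E) :=
  Algebra.TensorProduct.map Algebra.TensorProduct.includeRight Algebra.TensorProduct.includeRight

theorem dbl_R : O.dbl.R = i23 O.R * i13 O.R * (i24 O.R * i14 O.R) := by
  have e : O.dbl.R = ∑ i : O.ι × O.ι, O.π2 (O.l i.1 * O.l i.2) ⊗ₜ[F] (O.e i.1 ⊗ₜ[F] O.e i.2) := rfl
  have e1 : i23 O.R * i13 O.R = ∑ i, O.π2 (O.l i) ⊗ₜ[F] (O.e i ⊗ₜ[F] 1) := by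
    have h1 := O.L1 (f := fun x y z => (O.π x ⊗ₜ[F] O.π y) ⊗ₜ[F] (z ⊗ₜ[F] (1 : E))) ⟨by fun_prop, by fun_prop, by fun_prop⟩
    rw [R, map_sum, map_sum, Finset.sum_mul_sum, Finset.sum_comm]
    simp only [i23, i13, Algebra.TensorProduct.map_tmul, Algebra.TensorProduct.includeLeft_apply,
      Algebra.TensorProduct.includeRight_apply, Algebra.TensorProduct.tmul_mul_tmul, one_mul, mul_one]
    rw [← h1]
    refine Finset.sum_congr rfl fun i _ => ?_
    rw [pi_two_eq]
    exact (map_sw (F := F) (fun t => t ⊗ₜ[F] (O.e i ⊗ₜ[F] (1 : E))) (by fun_prop) _ _).symm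
  have e2 : i24 O.R * i14 O.R = ∑ i, O.π2 (O.l i) ⊗ₜ[F] (1 ⊗ₜ[F] O.e i) := by
    have h1 := O.L1 (f := fun x y z => (O.π x ⊗ₜ[F] O.π y) ⊗ₜ[F] ((1 : E) ⊗ₜ[F] z)) ⟨by fun_prop, by fun_prop, by fun_prop⟩
    rw [R, map_sum, map_sum, Finset.sum_mul_sum, Finset.sum_comm]
    simp only [i24, i14, Algebra.TensorProduct.map_tmul, Algebra.TensorProduct.includeLeft_apply,
      Algebra.TensorProduct.includeRight_apply, Algebra.TensorProduct.tmul_mul_tmul, one_mul, mul_one]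
    rw [← h1]
    refine Finset.sum_congr rfl fun i _ => ?_
    rw [pi_two_eq]
    exact (map_sw (F := F) (fun t => t ⊗ₜ[F] ((1 : E) ⊗ₜ[F] O.e i)) (by fun_prop) _ _).symm
  rw [e, e1, e2, Finset.sum_mul_sum, Fintype.sum_prod_type]
  simp only [map_mul, Algebra.TensorProduct.tmul_mul_tmul, mul_one, one_mul]

end Obj
end Xp

namespace Xp
set_option linter.unusedSectionVars false
set_option linter.unusedVariables false
universe u v v'

section lin
variable {F : Type u} [Field F] {U V E : Type v} [AddCommGroup U] [Module F U] [FiniteDimensional F U]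
  [AddCommGroup V] [Module F V] [FiniteDimensional F V]

theorem det_tmap (f : Module.End F U) (g : Module.End F V) : LinearMap.det (TensorProduct.map f g) =
    LinearMap.det f ^ Module.finrank F V * LinearMap.det g ^ Module.finrank F U := by
  classical
  let b := Module.finBasis F U
  let c := Module.finBasis F V
  rw [← LinearMap.det_toMatrix (b.tensorProduct c), TensorProduct.toMatrix_map, Matrix.det_kronecker,
    LinearMap.det_toMatrix, LinearMap.det_toMatrix]
  simp

theorem tmap_inj {E : Type*} [AddCommGroup E] [Module F E] (j : U →ₗ[F] E) (hj : Function.Injective j) :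
    Function.Injective (TensorProduct.map j j) := by
  obtain ⟨g, hg⟩ := LinearMap.exists_leftInverse_of_injective j (LinearMap.ker_eq_bot.mpr hj)
  apply Function.LeftInverse.injective (g := TensorProduct.map g g)
  intro t
  rw [← LinearMap.comp_apply, ← TensorProduct.map_comp, hg]
  simp

theorem det_conj' (e : U ≃ₗ[F] V) (f : Module.End F V) :
    LinearMap.det (e.symm.toLinearMap ∘ₗ f ∘ₗ e.toLinearMap) = LinearMap.det f :=
  LinearMap.det_conj f e.symm

variable [Ring E] [Algebra F E]

theorem slot_lemma (j : U →ₗ[F] E) (f : Module.End F (U ⊗[F] U)) (X : E ⊗[F] E)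
   (hf : ∀ t, TensorProduct.map j j (f t) = X * TensorProduct.map j j t)
   (σU : (U ⊗[F] U) ⊗[F] (U ⊗[F] U) ≃ₗ[F] (U ⊗[F] U) ⊗[F] (U ⊗[F] U))
   (σE : (E ⊗[F] E) ⊗[F] (E ⊗[F] E) ≃ₗ[F] (E ⊗[F] E) ⊗[F] (E ⊗[F] E))
   (i : E ⊗[F] E →ₐ[F] (E ⊗[F] E) ⊗[F] (E ⊗[F] E))
   (hnat : ∀ a b c d : U, σE (TensorProduct.map (TensorProduct.map j j) (TensorProduct.map j j) ((a ⊗ₜ b) ⊗ₜ (c ⊗ₜ d))) =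
     TensorProduct.map (TensorProduct.map j j) (TensorProduct.map j j) (σU ((a ⊗ₜ b) ⊗ₜ (c ⊗ₜ d))))
   (hi : ∀ x y a b c d : E, σE (i (x ⊗ₜ y) * ((a ⊗ₜ b) ⊗ₜ (c ⊗ₜ d))) = ((x ⊗ₜ[F] y) ⊗ₜ[F] 1) * σE ((a ⊗ₜ b) ⊗ₜ (c ⊗ₜ d)))
   (t : (U ⊗[F] U) ⊗[F] (U ⊗[F] U)) :
   TensorProduct.map (TensorProduct.map j j) (TensorProduct.map j j)
     ((σU.symm.toLinearMap ∘ₗ (TensorProduct.map f LinearMap.id) ∘ₗ σU.toLinearMap) t) =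
    i X * TensorProduct.map (TensorProduct.map j j) (TensorProduct.map j j) t := by
  set J := TensorProduct.map (TensorProduct.map j j) (TensorProduct.map j j) with hJ
  have hnat' : σE.toLinearMap ∘ₗ J = J ∘ₗ σU.toLinearMap := by
    refine TensorProduct.ext_fourfold' fun a b c d => ?_
    exact hnat a b c d
  have hi' : ∀ X y, σE (i X * y) = (X ⊗ₜ[F] 1) * σE y := by
    intro X y
    induction X with
    | zero => simp
    | add p q hp hq => rw [map_add, add_mul, map_add, hp, hq, TensorProduct.add_tmul, add_mul]
    | tmul p q =>
      have : σE.toLinearMap ∘ₗ LinearMap.mulLeft F (i (p ⊗ₜ q)) =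
        LinearMap.mulLeft F ((p ⊗ₜ[F] q) ⊗ₜ[F] (1 : E ⊗[F] E)) ∘ₗ σE.toLinearMap := by
        refine TensorProduct.ext_fourfold' fun a b c d => ?_
        exact hi p q a b c d
      exact LinearMap.congr_fun this y
  have hf' : ∀ t, J (TensorProduct.map f LinearMap.id t) = (X ⊗ₜ[F] 1) * J t := by
    intro t
    induction t with
    | zero => simp
    | add p q hp hq => rw [map_add, map_add, hp, hq, map_add, mul_add]
    | tmul p q => simp [hJ, hf]
  apply σE.injective
  have h1 : ∀ t, σE (J t) = J (σU t) := fun t => LinearMap.congr_fun hnat' t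
  rw [hi', h1, h1, ← hf']
  simp
end lin

theorem small_zero {x C : ℚ} (h : ∀ n : ℕ, (2 : ℚ) ^ n * |x| ≤ C) : x = 0 := by
  by_contra hx
  have hx' : 0 < |x| := abs_pos.mpr hx
  obtain ⟨n, hn⟩ := pow_unbounded_of_one_lt (C / |x|) (by norm_num : (1 : ℚ) < 2)
  rw [div_lt_iff₀ hx'] at hn
  exact absurd (h n) (not_le.mpr hn)

theorem slope_arith {t a M : ℚ} (h : ∀ n : ℕ, |(2 : ℚ) ^ n * t - a * (4 ^ n - 2 ^ n)| ≤ M) : t = 0 := by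
  have ha : a = 0 := by
    apply small_zero (C := 3 * M)
    intro n
    have h1 := h n
    have h2 := h (n + 1)
    have h3 : (2 : ℚ) ^ n * |a| ≤ 2 * 4 ^ n * |a| := by
      apply mul_le_mul_of_nonneg_right _ (abs_nonneg _)
      have : (2 : ℚ) ^ n ≤ 4 ^ n := by gcongr; norm_num
      have : (0 : ℚ) < 4 ^ n := by positivity
      linarith
    have h4 : 2 * 4 ^ n * |a| = |2 * ((2 : ℚ) ^ n * t - a * (4 ^ n - 2 ^ n)) - ((2 : ℚ) ^ (n+1) * t - a * (4 ^ (n+1) - 2 ^ (n+1)))| := by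
      rw [← abs_of_pos (show (0 : ℚ) < 2 * 4 ^ n by positivity), ← abs_mul]
      congr 1; ring
    rw [h4] at h3
    refine h3.trans ((abs_sub _ _).trans ?_)
    rw [abs_mul]; norm_num; linarith
  subst ha
  apply small_zero (C := M)
  intro n
  have := h n
  rw [zero_mul, sub_zero, abs_mul, abs_of_pos (by positivity)] at this
  exact this

section good
variable (F : Type u) [Field F] (A : Type v') [Ring A] [HopfAlgebra F A] [FiniteDimensional F A]

/-- a part of an object stable under the Drinfeld element and the R-operator -/
def Good (U : Type v) [AddCommGroup U] [Module F U] (α : Module.End F U) (ρ : Module.End F (U ⊗[F] U)) : Prop :=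
  ∃ (E : Type v) (_ : Ring E) (_ : Algebra F E) (_ : FiniteDimensional F E) (O : Obj F A E) (j : U →ₗ[F] E),
    Function.Injective j ∧ (∀ u, j (α u) = O.w * j u) ∧
     (∀ t, TensorProduct.map j j (ρ t) = O.R * TensorProduct.map j j t)

variable {F A}
variable {U : Type v} [AddCommGroup U] [Module F U] [FiniteDimensional F U] {α : Module.End F U}
  {ρ : Module.End F (U ⊗[F] U)}

structure Slope (ψ : F → ℚ) : Prop where
  mul : ∀ x y, x ≠ 0 → y ≠ 0 → ψ (x * y) = ψ x + ψ y

theorem Slope.one {ψ : F → ℚ} (h : Slope ψ) : ψ 1 = 0 := by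
  have := h.mul 1 1 one_ne_zero one_ne_zero
  rw [mul_one] at this; linarith

theorem Slope.pow {ψ : F → ℚ} (h : Slope ψ) {x : F} (hx : x ≠ 0) (n : ℕ) : ψ (x ^ n) = n * ψ x := by
  induction n with
  | zero => simp [h.one]
  | succ n ih => rw [pow_succ, h.mul _ _ (pow_ne_zero _ hx) hx, ih]; push_cast; ring

theorem Slope.prod {ψ : F → ℚ} (h : Slope ψ) (s : Multiset F) (hs : ∀ x ∈ s, x ≠ 0) : ψ s.prod = (s.map ψ).sum := by
  induction s using Multiset.induction_on with
  | empty => simp [h.one]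
  | cons a s ih =>
    have h1 : ∀ x ∈ s, x ≠ 0 := fun x hx => hs x (Multiset.mem_cons_of_mem hx)
    have h2 : s.prod ≠ 0 := fun h0 => h1 0 (by simpa using h0) rfl
    rw [Multiset.prod_cons, h.mul _ _ (hs a (Multiset.mem_cons_self a s)) h2, ih h1]; simp

theorem exists_inv_left {E : Type*} [Ring E] [Algebra F E] [FiniteDimensional F E] {x y : E} (h : x * y = 1) : y * x = 1 := by
  have : IsNoetherian F E := inferInstance
  have hs : Function.Injective (LinearMap.mulLeft F y) := by
    intro a b hab
    have := congrArg (x * ·) hab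
    simpa [← mul_assoc, h] using this
  obtain ⟨z, hz⟩ := (LinearMap.injective_iff_surjective.mp hs) 1
  have hz' : y * z = 1 := hz
  have : x = z := left_inv_eq_right_inv h hz'
  rw [this, hz']

theorem Good.inj (T : A →ₗ[F] A) (hT : ∀ x, HopfAlgebra.antipode F (HopfAlgebra.antipode F (T x)) = x)
    (h : Good F A U α ρ) : Function.Injective α ∧ Function.Injective ρ := by
  obtain ⟨E, _, _, _, O, j, hj, hα, hρ⟩ := h
  have hjj := tmap_inj j hj
  obtain ⟨w', hw'⟩ : ∃ w', O.w * w' = 1 := ⟨_, O.w_inv T hT⟩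
  have hw := exists_inv_left (F := F) hw'
  have hR : (O.R21 * O.dbl.w * (w' ⊗ₜ[F] w')) * O.R = 1 := by
    apply exists_inv_left (F := F)
    rw [← mul_assoc, ← mul_assoc, O.R_R21_w, Algebra.TensorProduct.tmul_mul_tmul, hw', Algebra.TensorProduct.one_def]
  constructor
  · intro a b hab
    apply hj
    have : O.w * j a = O.w * j b := by rw [← hα, ← hα, hab]
    have := congrArg (w' * ·) this
    simpa [← mul_assoc, hw] using this
  · intro a b hab
    apply hjj
    have : O.R * TensorProduct.map j j a = O.R * TensorProduct.map j j b := by rw [← hρ, ← hρ, hab]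
    have := congrArg ((O.R21 * O.dbl.w * (w' ⊗ₜ[F] w')) * ·) this
    simp only [← mul_assoc (O.R21 * O.dbl.w * (w' ⊗ₜ[F] w')), hR, one_mul] at this
    exact this

theorem det_ne {V : Type*} [AddCommGroup V] [Module F V] [FiniteDimensional F V] {f : Module.End F V} (h : Function.Injective f) : LinearMap.det f ≠ 0 := by
  have := LinearEquiv.isUnit_det' (LinearEquiv.ofInjectiveEndo f h)
  exact this.ne_zero

theorem Good.bound [DecidableEq F] [IsAlgClosed F] (T : A →ₗ[F] A) (hT : ∀ x, HopfAlgebra.antipode F (HopfAlgebra.antipode F (T x)) = x)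
    (h : Good F A U α ρ) (ψ : F → ℚ) (hψ : Slope ψ) :
    |ψ (LinearMap.det α)| ≤ Module.finrank F U * ∑ x ∈ (LinearMap.charpoly (Obj.Bop F A)).roots.toFinset, |ψ x| := by
  have hinj := (h.inj T hT).1
  obtain ⟨E, _, _, _, O, j, hj, hα, hρ⟩ := h
  have hq : ∀ (q : Polynomial F) u, j (Polynomial.aeval α q u) = Polynomial.aeval O.w q * j u := by
    intro q u
    have hp : ∀ n, j ((α ^ n) u) = O.w ^ n * j u := by
      intro n
      induction n with
      | zero => simp
      | succ n ih => rw [pow_succ', Module.End.mul_apply, hα, ih, pow_succ', mul_assoc]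
    induction q using Polynomial.induction_on' with
    | add p q hp hq => simp only [map_add, LinearMap.add_apply, hp, hq, add_mul]
    | monomial n a =>
      rw [Polynomial.aeval_monomial, Polynomial.aeval_monomial, Module.algebraMap_end_eq_smul_id]
      simp only [Module.End.mul_apply, LinearMap.smul_apply, LinearMap.id_apply, map_smul, hp]
      rw [Algebra.smul_def, mul_assoc]
  set Q := LinearMap.charpoly (Obj.Bop F A) with hQ
  have hQ0 : Q ≠ 0 := (LinearMap.charpoly_monic _).ne_zero
  have hroot : ∀ μ ∈ α.charpoly.roots, μ ≠ 0 ∧ μ ∈ Q.roots.toFinset := by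
    intro μ hμ
    have h1 : α.HasEigenvalue μ := by
      rw [Module.End.hasEigenvalue_iff_isRoot_charpoly]
      exact Polynomial.isRoot_of_mem_roots hμ
    obtain ⟨x, hx⟩ := h1.exists_hasEigenvector
    constructor
    · rintro rfl
      apply hx.2
      apply hinj
      rw [hx.apply_eq_smul]; simp
    · rw [Multiset.mem_toFinset, Polynomial.mem_roots hQ0]
      have h2 := hq Q x
      rw [O.aeval_w, zero_mul, Module.End.aeval_apply_of_hasEigenvector hx, map_smul, smul_eq_zero] at h2
      rcases h2 with h2 | h2
      · exact h2
      · exact absurd (hj (by simpa using h2)) hx.2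
  rw [Module.End.det_eq_prod_roots_charpoly_of_splits (IsAlgClosed.splits _), hψ.prod _ fun x hx => (hroot x hx).1]
  have hcard : (α.charpoly.roots).card = Module.finrank F U := by
    rw [← LinearMap.charpoly_natDegree α, ← (Polynomial.splits_iff_card_roots.mp (IsAlgClosed.splits _))]
  have hb : ∀ s : Multiset F, (∀ x ∈ s, x ∈ Q.roots.toFinset) → |(s.map ψ).sum| ≤ s.card * ∑ x ∈ Q.roots.toFinset, |ψ x| := by
    intro s
    induction s using Multiset.induction_on with
    | empty => simp
    | cons a s ih =>
      intro hs
      rw [Multiset.map_cons, Multiset.sum_cons, Multiset.card_cons]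
      have h1 := ih fun x hx => hs x (Multiset.mem_cons_of_mem hx)
      have h2 : |ψ a| ≤ ∑ x ∈ Q.roots.toFinset, |ψ x| :=
        Finset.single_le_sum (f := fun x => |ψ x|) (fun i _ => abs_nonneg (ψ i)) (hs a (Multiset.mem_cons_self a s))
      refine (abs_add_le _ _).trans ?_
      push_cast
      linarith
  have := hb _ fun x hx => (hroot x hx).2
  rwa [hcard] at this

theorem Good.dbl (T : A →ₗ[F] A) (hT : ∀ x, HopfAlgebra.antipode F (HopfAlgebra.antipode F (T x)) = x)
    (h : Good F A U α ρ) : ∃ (α' : Module.End F (U ⊗[F] U)) (ρ' : Module.End F ((U ⊗[F] U) ⊗[F] (U ⊗[F] U))),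
      Good F A (U ⊗[F] U) α' ρ' ∧ LinearMap.det ρ * LinearMap.det ρ * LinearMap.det α' =
       LinearMap.det α ^ Module.finrank F U * LinearMap.det α ^ Module.finrank F U ∧
       LinearMap.det ρ' = (LinearMap.det ρ ^ (Module.finrank F U * Module.finrank F U)) ^ 4 := by
  have hinj := h.inj T hT
  obtain ⟨E, _, _, _, O, j, hj, hα, hρ⟩ := h
  have hjj := tmap_inj j hj
  let cU := TensorProduct.comm F U U
  let cE := TensorProduct.comm F E E
  have hρ21 : ∀ t, TensorProduct.map j j ((cU.symm.toLinearMap ∘ₗ ρ ∘ₗ cU.toLinearMap) t) = O.R21 * TensorProduct.map j j t := by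
    have hc : ∀ t, cE (TensorProduct.map j j t) = TensorProduct.map j j (cU t) := by
      intro t
      exact (TensorProduct.map_comm j j t).symm
    intro t
    apply cE.injective
    rw [hc]
    simp only [LinearMap.comp_apply, LinearEquiv.coe_coe, LinearEquiv.apply_symm_apply, hρ]
    have hm : ∀ x y, cE (x * y) = cE x * cE y := fun x y => map_mul (Algebra.TensorProduct.comm F E E) x y
    rw [hm, hc]
    congr 1
    exact O.comm_R21.symm
  set ρ21 := cU.symm.toLinearMap ∘ₗ ρ ∘ₗ cU.toLinearMap with hrho_d
  have hd21 : LinearMap.det ρ21 = LinearMap.det ρ := det_conj' cU ρ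
  have hinj21 : Function.Injective ρ21 := by
    simp only [hrho_d, LinearMap.coe_comp]
    exact cU.symm.injective.comp (hinj.2.comp cU.injective)
  have hi2 : Function.Injective (ρ ∘ₗ ρ21) := hinj.2.comp hinj21
  let e := LinearEquiv.ofInjectiveEndo _ hi2
  have he : ∀ t, ρ (ρ21 (e.symm t)) = t := fun t => e.apply_symm_apply t
  let α' : Module.End F (U ⊗[F] U) := e.symm.toLinearMap ∘ₗ TensorProduct.map α α
  have hα'1 : ∀ t, ρ (ρ21 (α' t)) = TensorProduct.map α α t := fun t => he _
  have hα'2 : ∀ t, TensorProduct.map j j (α' t) = O.dbl.w * TensorProduct.map j j t := by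
    intro t
    have h1 := congrArg (TensorProduct.map j j) (hα'1 t)
    have h2 : TensorProduct.map j j (TensorProduct.map α α t) = (O.w ⊗ₜ[F] O.w) * TensorProduct.map j j t := by
      clear h1
      induction t with
      | zero => simp
      | add p q hp hq => simp only [map_add, hp, hq, mul_add]
      | tmul p q => simp [hα]
    rw [hρ, hρ21, h2, ← O.R_R21_w] at h1
    have hR : ∃ z, z * (O.R * O.R21) = 1 := by
      obtain ⟨w', hw'⟩ : ∃ w', O.w * w' = 1 := ⟨_, O.w_inv T hT⟩
      refine ⟨O.dbl.w * (w' ⊗ₜ[F] w'), exists_inv_left (F := F) ?_⟩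
      rw [← mul_assoc, O.R_R21_w, Algebra.TensorProduct.tmul_mul_tmul, hw', Algebra.TensorProduct.one_def]
    obtain ⟨z, hz⟩ := hR
    have h3 := congrArg (z * ·) h1
    simp only [← mul_assoc] at h3 hz
    simpa [hz] using h3
  let τU := TensorProduct.tensorTensorTensorComm F U U U U
  let τE := TensorProduct.tensorTensorTensorComm F E E E E
  let iU := LinearEquiv.refl F (U ⊗[F] U)
  let iE := LinearEquiv.refl F (E ⊗[F] E)
  have s13 := slot_lemma j ρ O.R hρ τU τE Obj.i13 (by intros; simp [τU, τE]) (by intros; simp [τE, Obj.i13])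
  have s24 := slot_lemma j ρ O.R hρ ((TensorProduct.congr cU cU).trans τU) ((TensorProduct.congr cE cE).trans τE) Obj.i24
    (by intros; simp [τU, τE, cU, cE]) (by intros; simp [τE, cE, Obj.i24])
  have s14 := slot_lemma j ρ O.R hρ ((TensorProduct.congr iU cU).trans τU) ((TensorProduct.congr iE cE).trans τE) Obj.i14
    (by intros; simp [τU, τE, cU, cE, iU, iE]) (by intros; simp [τE, cE, iE, Obj.i14])
  have s23 := slot_lemma j ρ O.R hρ ((TensorProduct.congr cU iU).trans τU) ((TensorProduct.congr cE iE).trans τE) Obj.i23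
    (by intros; simp [τU, τE, cU, cE, iU, iE]) (by intros; simp [τE, cE, iE, Obj.i23])
  have hdet : ∀ σ : (U ⊗[F] U) ⊗[F] (U ⊗[F] U) ≃ₗ[F] (U ⊗[F] U) ⊗[F] (U ⊗[F] U),
     LinearMap.det (σ.symm.toLinearMap ∘ₗ (TensorProduct.map ρ LinearMap.id) ∘ₗ σ.toLinearMap) =
      LinearMap.det ρ ^ (Module.finrank F U * Module.finrank F U) := by
    intro σ
    rw [det_conj', det_tmap]
    simp
  have d13 := hdet τU
  have d24 := hdet ((TensorProduct.congr cU cU).trans τU)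
  have d14 := hdet ((TensorProduct.congr iU cU).trans τU)
  have d23 := hdet ((TensorProduct.congr cU iU).trans τU)
  generalize (τU.symm.toLinearMap ∘ₗ (TensorProduct.map ρ LinearMap.id) ∘ₗ τU.toLinearMap) = r13 at *
  generalize (((TensorProduct.congr cU cU).trans τU).symm.toLinearMap ∘ₗ (TensorProduct.map ρ LinearMap.id) ∘ₗ ((TensorProduct.congr cU cU).trans τU).toLinearMap) = r24 at *
  generalize (((TensorProduct.congr iU cU).trans τU).symm.toLinearMap ∘ₗ (TensorProduct.map ρ LinearMap.id) ∘ₗ ((TensorProduct.congr iU cU).trans τU).toLinearMap) = r14 at *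
  generalize (((TensorProduct.congr cU iU).trans τU).symm.toLinearMap ∘ₗ (TensorProduct.map ρ LinearMap.id) ∘ₗ ((TensorProduct.congr cU iU).trans τU).toLinearMap) = r23 at *
  refine ⟨α', r23 ∘ₗ r13 ∘ₗ r24 ∘ₗ r14, ⟨E ⊗[F] E, inferInstance, inferInstance, inferInstance, O.dbl, TensorProduct.map j j, hjj, hα'2, ?_⟩, ?_, ?_⟩
  · intro t
    simp only [LinearMap.comp_apply, s23, s13, s24, s14, O.dbl_R, mul_assoc]
  · have : ρ ∘ₗ ρ21 ∘ₗ α' = TensorProduct.map α α := LinearMap.ext hα'1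
    have := congrArg LinearMap.det this
    rw [LinearMap.det_comp, LinearMap.det_comp, det_tmap, hd21] at this
    rw [← this, mul_assoc]
  · simp only [LinearMap.det_comp, d13, d24, d14, d23]; ring

theorem Good.slopes [DecidableEq F] [IsAlgClosed F] (T : A →ₗ[F] A) (hT : ∀ x, HopfAlgebra.antipode F (HopfAlgebra.antipode F (T x)) = x)
    (ψ : F → ℚ) (hψ : Slope ψ) (n : ℕ) : ∀ {U : Type v} [AddCommGroup U] [Module F U] [FiniteDimensional F U] {α : Module.End F U}
  {ρ : Module.End F (U ⊗[F] U)} (h : Good F A U α ρ) (hU : 0 < Module.finrank F U),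
    |(2 : ℚ) ^ n * (ψ (LinearMap.det α) / Module.finrank F U) -
       (ψ (LinearMap.det ρ) / (Module.finrank F U * Module.finrank F U)) * (4 ^ n - 2 ^ n)|
       ≤ ∑ x ∈ (LinearMap.charpoly (Obj.Bop F A)).roots.toFinset, |ψ x| := by
  induction n with
  | zero =>
    intro U _ _ _ α ρ h hU
    have h1 := h.bound T hT ψ hψ
    have h2 : (0 : ℚ) < Module.finrank F U := by exact_mod_cast hU
    simp only [pow_zero, one_mul, sub_self, mul_zero, sub_zero]
    rw [abs_div, abs_of_pos h2, div_le_iff₀ h2, mul_comm]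
    exact h1
  | succ n ih =>
    intro U _ _ _ α ρ h hU
    have hinj := h.inj T hT
    obtain ⟨α', ρ', h', e1, e2⟩ := h.dbl T hT
    have hinj' := h'.inj T hT
    have hU' : 0 < Module.finrank F (U ⊗[F] U) := by rw [Module.finrank_tensorProduct]; positivity
    have h3 := ih h' hU'
    have h2 : (0 : ℚ) < Module.finrank F U := by exact_mod_cast hU
    have a1 := det_ne hinj.1
    have a2 := det_ne hinj.2
    have a3 := det_ne hinj'.1
    have e1' := congrArg ψ e1
    rw [hψ.mul _ _ (mul_ne_zero a2 a2) a3, hψ.mul _ _ a2 a2, hψ.mul _ _ (pow_ne_zero _ a1) (pow_ne_zero _ a1),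
      hψ.pow a1] at e1'
    have e2' := congrArg ψ e2
    rw [hψ.pow (pow_ne_zero _ a2), hψ.pow a2] at e2'
    have e1'' : ψ (LinearMap.det α') = 2 * (Module.finrank F U * ψ (LinearMap.det α)) - 2 * ψ (LinearMap.det ρ) := by linarith
    rw [e1'', e2', Module.finrank_tensorProduct] at h3
    refine le_of_eq_of_le ?_ h3
    congr 1
    push_cast
    field_simp
    ring

theorem Good.slope_zero [IsAlgClosed F] (T : A →ₗ[F] A) (hT : ∀ x, HopfAlgebra.antipode F (HopfAlgebra.antipode F (T x)) = x)
    (ψ : F → ℚ) (hψ : Slope ψ) (h : Good F A U α ρ) (hU : 0 < Module.finrank F U) : ψ (LinearMap.det α) = 0 := by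
  have h2 : (Module.finrank F U : ℚ) ≠ 0 := by exact_mod_cast hU.ne'
  classical
  have := slope_arith fun n => Good.slopes T hT ψ hψ n h hU
  rw [div_eq_zero_iff] at this
  exact this.resolve_right h2
end good
end Xp

namespace Xp
set_option linter.unusedSectionVars false
set_option linter.unusedVariables false
universe u v v'

section top
variable {F : Type u} [Field F] {V : Type v} [AddCommGroup V] [Module F V] [FiniteDimensional F V]

theorem tmul_mem_gen (W : Module.End F V) {μ ν : F} {x y : V} (hx : x ∈ W.maxGenEigenspace μ) (hy : y ∈ W.maxGenEigenspace ν) :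
    x ⊗ₜ[F] y ∈ Module.End.maxGenEigenspace (TensorProduct.map W W) (μ * ν) := by
  rw [Module.End.mem_maxGenEigenspace] at *
  obtain ⟨k, hk⟩ := hx
  obtain ⟨l, hl⟩ := hy
  refine ⟨k + l, ?_⟩
  let a : Module.End F (V ⊗[F] V) := TensorProduct.map (W - μ • 1) W
  let b : Module.End F (V ⊗[F] V) := TensorProduct.map (μ • 1) (W - ν • 1)
  have hab : TensorProduct.map W W - (μ * ν) • (1 : Module.End F (V ⊗[F] V)) = a + b := by
    refine TensorProduct.ext' fun x y => ?_
    simp only [a, b, LinearMap.sub_apply, LinearMap.add_apply, TensorProduct.map_tmul, LinearMap.smul_apply,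
      Module.End.one_apply, TensorProduct.sub_tmul, TensorProduct.tmul_sub, TensorProduct.smul_tmul', TensorProduct.tmul_smul,
      smul_smul, mul_comm]
    abel_nf
    try simp [mul_comm]
  have hc : Commute a b := by
    refine TensorProduct.ext' fun x y => ?_
    simp [a, b, Module.End.mul_apply, TensorProduct.sub_tmul, TensorProduct.tmul_sub, smul_sub]
    abel
  rw [hab, hc.add_pow, LinearMap.sum_apply]
  refine Finset.sum_eq_zero fun m hm => ?_
  have ha : ∀ (n : ℕ) (x y : V), (a ^ n) (x ⊗ₜ y) = ((W - μ • 1) ^ n) x ⊗ₜ (W ^ n) y := by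
    intro n x y
    simp only [a, TensorProduct.map_pow, TensorProduct.map_tmul]
  have hb : ∀ (n : ℕ) (x y : V), (b ^ n) (x ⊗ₜ y) = ((μ • (1 : Module.End F V)) ^ n) x ⊗ₜ ((W - ν • 1) ^ n) y := by
    intro n x y
    simp only [b, TensorProduct.map_pow, TensorProduct.map_tmul]
  have hz : (a ^ m * b ^ (k + l - m)) (x ⊗ₜ y) = 0 := by
    rcases le_or_gt k m with h | h
    · rw [(hc.pow_pow m (k+l-m)).eq, Module.End.mul_apply, ha, show m = (m - k) + k by omega, pow_add, Module.End.mul_apply,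
        hk]
      simp
    · rw [Module.End.mul_apply, hb, show k + l - m = (k - m) + l by omega, pow_add, pow_add, Module.End.mul_apply, 
        Module.End.mul_apply, hl]
      simp
  rw [(Nat.cast_commute _ _).symm.eq, Module.End.mul_apply, hz, map_zero]

theorem indep_eq {ι L : Type*} [CompleteLattice L] [IsModularLattice L] {g N : ι → L} (hg : iSupIndep g) (hN : ∀ i, N i ≤ g i)
    (ht : ⨆ i, N i = ⊤) (i : ι) : N i = g i := by
  have h1 : N i ⊔ ⨆ (j) (_ : j ≠ i), N j = ⊤ := by
    rw [eq_top_iff, ← ht]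
    refine iSup_le fun j => ?_
    by_cases h : j = i
    · subst h; exact le_sup_left
    · exact le_sup_of_le_right (le_iSup₂_of_le j h le_rfl)
  have h2 : (⨆ (j) (_ : j ≠ i), N j) ⊓ g i = ⊥ := by
    rw [eq_bot_iff]
    have := (hg i).eq_bot
    rw [← this, inf_comm]
    exact inf_le_inf_left _ (iSup₂_mono fun j _ => hN j)
  have h3 := sup_inf_assoc_of_le (⨆ (j) (_ : j ≠ i), N j) (hN i)
  rw [h1, h2, top_inf_eq, sup_bot_eq] at h3
  exact h3.symm

/-- top slope part -/
def topU (W : Module.End F V) (ψ : F → ℚ) (s : ℚ) : Submodule F V :=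
  ⨆ μ : {μ : F // μ ≠ 0 ∧ ψ μ = s}, W.maxGenEigenspace μ.1

theorem eig_of_ne (W : Module.End F V) {μ : F} (h : W.maxGenEigenspace μ ≠ ⊥) : W.HasEigenvalue μ :=
  Module.End.HasUnifEigenvalue.lt (k := ⊤) zero_lt_one h

theorem topU_stable [IsAlgClosed F] (W : Module.End F V) (ψ : F → ℚ) (hψ : Slope ψ) (s : ℚ)
    (hs : ∀ μ, W.HasEigenvalue μ → ψ μ ≤ s) (R : Module.End F (V ⊗[F] V)) (hR : Commute (TensorProduct.map W W) R) :
    Submodule.map₂ (TensorProduct.mk F V V) (topU W ψ s) (topU W ψ s) ≤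
     (Submodule.map₂ (TensorProduct.mk F V V) (topU W ψ s) (topU W ψ s)).comap R := by
  let G := W.maxGenEigenspace
  let GG := Module.End.maxGenEigenspace (TensorProduct.map W W)
  let N : F → Submodule F (V ⊗[F] V) := fun c => ⨆ p : {p : F × F // p.1 * p.2 = c},
    Submodule.map₂ (TensorProduct.mk F V V) (G p.1.1) (G p.1.2)
  have h0 : ∀ μ ν, Submodule.map₂ (TensorProduct.mk F V V) (G μ) (G ν) ≤ GG (μ * ν) := by
    intro μ ν
    rw [Submodule.map₂_le]
    intro x hx y hy
    exact tmul_mem_gen W hx hy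
  have h1 : ∀ c, N c ≤ GG c := by
    intro c
    refine iSup_le ?_
    rintro ⟨⟨μ, ν⟩, rfl⟩
    exact h0 μ ν
  have h2 : ⨆ c, N c = ⊤ := by
    rw [eq_top_iff, ← TensorProduct.map₂_mk_top_top_eq_top, ← Module.End.iSup_maxGenEigenspace_eq_top W, Submodule.map₂_iSup_left]
    refine iSup_le fun μ => ?_
    rw [Submodule.map₂_iSup_right]
    refine iSup_le fun ν => ?_
    refine le_iSup_of_le (μ * ν) ?_
    exact le_iSup_of_le (⟨(μ, ν), rfl⟩ : {p : F × F // p.1 * p.2 = μ * ν}) le_rfl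
  have h3 : ∀ c, N c = GG c := indep_eq (Module.End.independent_maxGenEigenspace _) h1 h2
  have h4 : ∀ c, c ≠ 0 → ψ c = s + s → N c ≤ Submodule.map₂ (TensorProduct.mk F V V) (topU W ψ s) (topU W ψ s) := by
    intro c hc hcs
    refine iSup_le ?_
    rintro ⟨⟨μ, ν⟩, rfl⟩
    have hμ : μ ≠ 0 := left_ne_zero_of_mul hc
    have hν : ν ≠ 0 := right_ne_zero_of_mul hc
    by_cases e1 : G μ = ⊥
    · simp only [e1, Submodule.map₂_bot_left, bot_le]
    by_cases e2 : G ν = ⊥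
    · simp only [e2, Submodule.map₂_bot_right, bot_le]
    have a1 := hs μ (eig_of_ne W e1)
    have a2 := hs ν (eig_of_ne W e2)
    simp only at hcs
    rw [hψ.mul _ _ hμ hν] at hcs
    refine Submodule.map₂_le_map₂ ?_ ?_
    · exact le_iSup_of_le (⟨μ, hμ, by linarith⟩ : {μ : F // μ ≠ 0 ∧ ψ μ = s}) le_rfl
    · exact le_iSup_of_le (⟨ν, hν, by linarith⟩ : {μ : F // μ ≠ 0 ∧ ψ μ = s}) le_rfl
  conv_lhs => rw [topU, Submodule.map₂_iSup_left]
  refine iSup_le fun μ => ?_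
  rw [Submodule.map₂_iSup_right]
  refine iSup_le fun ν => ?_
  refine (h0 μ ν).trans ?_
  intro t ht
  have h5 := Module.End.mapsTo_maxGenEigenspace_of_comm hR _ ht
  refine h4 (μ * ν) (mul_ne_zero μ.2.1 ν.2.1) ?_ ?_
  · rw [hψ.mul _ _ μ.2.1 ν.2.1, μ.2.2, ν.2.2]
  · rw [h3]; exact h5
end top

section app
variable {F : Type u} [Field F] {A : Type v'} [Ring A] [HopfAlgebra F A] [FiniteDimensional F A]
  {E : Type v} [Ring E] [Algebra F E] [FiniteDimensional F E]

theorem Obj.slope_le [IsAlgClosed F] (T : A →ₗ[F] A) (hT : ∀ x, HopfAlgebra.antipode F (HopfAlgebra.antipode F (T x)) = x)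
    (O : Obj F A E) (ψ : F → ℚ) (hψ : Slope ψ) (μ : F) (hμ : Module.End.HasEigenvalue (LinearMap.mulLeft F O.w) μ) : ψ μ ≤ 0 := by
  classical
  set W : Module.End F E := LinearMap.mulLeft F O.w with hW
  have hfin : (LinearMap.charpoly W).roots.toFinset.Nonempty := by
    refine ⟨μ, ?_⟩
    rw [Multiset.mem_toFinset, Polynomial.mem_roots (LinearMap.charpoly_monic _).ne_zero]
    exact (Module.End.hasEigenvalue_iff_isRoot_charpoly _ _).mp hμ
  obtain ⟨μ0, hμ0, hmax⟩ := Finset.exists_max_image _ ψ hfin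
  have hmax' : ∀ ν, W.HasEigenvalue ν → ψ ν ≤ ψ μ0 := by
    intro ν hν
    apply hmax
    rw [Multiset.mem_toFinset, Polynomial.mem_roots (LinearMap.charpoly_monic _).ne_zero]
    exact (Module.End.hasEigenvalue_iff_isRoot_charpoly _ _).mp hν
  have hmu_e : W.HasEigenvalue μ0 := by
    rw [Multiset.mem_toFinset, Polynomial.mem_roots (LinearMap.charpoly_monic _).ne_zero] at hμ0
    exact (Module.End.hasEigenvalue_iff_isRoot_charpoly _ _).mpr hμ0
  refine (hmax' μ hμ).trans ?_
  set s := ψ μ0 with hs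
  obtain ⟨w', hw'⟩ : ∃ w', O.w * w' = 1 := ⟨_, O.w_inv T hT⟩
  have hw := exists_inv_left (F := F) hw'
  have hWinj : Function.Injective W := by
    intro a b hab
    have := congrArg (w' * ·) hab
    simpa [hW, ← mul_assoc, hw] using this
  have hne : ∀ ν, W.HasEigenvalue ν → ν ≠ 0 := by
    rintro ν hν rfl
    obtain ⟨x, hx⟩ := hν.exists_hasEigenvector
    exact hx.2 (hWinj (by rw [hx.apply_eq_smul]; simp))
  let U := topU W ψ s
  let Rm := LinearMap.mulLeft F O.R
  have hWW : TensorProduct.map W W = LinearMap.mulLeft F (O.w ⊗ₜ[F] O.w) := by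
    refine TensorProduct.ext' fun x y => ?_
    simp [hW]
  have hcomm : Commute (TensorProduct.map W W) Rm := by
    rw [hWW]
    refine LinearMap.ext fun t => ?_
    simp only [Rm, Module.End.mul_apply, LinearMap.mulLeft_apply, ← mul_assoc, O.R_comm]
  have hst := topU_stable W ψ hψ s hmax' Rm hcomm
  let j : U →ₗ[F] E := U.subtype
  have hj : Function.Injective j := U.injective_subtype
  have hjj := tmap_inj j hj
  have hrange : LinearMap.range (TensorProduct.map j j) = Submodule.map₂ (TensorProduct.mk F E E) U U := by
    rw [TensorProduct.range_map, Submodule.range_subtype]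
  rw [← hrange] at hst
  have hWU : ∀ x ∈ U, W x ∈ U := by
    have : U ≤ U.comap W := by
      conv_lhs => rw [show U = topU W ψ s from rfl, topU]
      refine iSup_le fun ν => ?_
      intro x hx
      have h1 := Module.End.mapsTo_maxGenEigenspace_of_comm (Commute.refl W) ν.1 hx
      exact (le_iSup (fun ν : {μ : F // μ ≠ 0 ∧ ψ μ = s} => W.maxGenEigenspace ν.1) ν) h1
    exact this
  let α : Module.End F U := W.restrict hWU
  let e := LinearEquiv.ofInjective (TensorProduct.map j j) hjj
  let ρ : Module.End F (U ⊗[F] U) := e.symm.toLinearMap ∘ₗ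
    (LinearMap.codRestrict (LinearMap.range (TensorProduct.map j j)) (Rm ∘ₗ TensorProduct.map j j) (fun t => hst ⟨t, rfl⟩))
  have hgood : Good F A U α ρ := by
    refine ⟨E, inferInstance, inferInstance, inferInstance, O, j, hj, fun u => rfl, fun t => ?_⟩
    have h1 : ∀ z, TensorProduct.map j j (e.symm z) = z.1 := fun z => congrArg Subtype.val (e.apply_symm_apply z)
    exact h1 _
  have hmu_U : U ≠ ⊥ := by
    obtain ⟨x, hx⟩ := hmu_e.exists_hasEigenvector
    intro h0
    have : x ∈ U := (le_iSup (fun ν : {μ : F // μ ≠ 0 ∧ ψ μ = s} => W.maxGenEigenspace ν.1) ⟨μ0, hne _ hmu_e, rfl⟩)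
      (Module.End.eigenspace_le_maxGenEigenspace hx.1)
    rw [h0] at this
    exact hx.2 this
  have hU : 0 < Module.finrank F U := by
    rw [Module.finrank_pos_iff]
    exact (Submodule.nontrivial_iff_ne_bot).mpr hmu_U
  have hz := hgood.slope_zero T hT ψ hψ hU
  have hαeig : ∀ ν ∈ (LinearMap.charpoly α).roots, ν ≠ 0 ∧ ψ ν = s := by
    intro ν hν
    have h1 : α.HasEigenvalue ν := by
      rw [Module.End.hasEigenvalue_iff_isRoot_charpoly]
      exact Polynomial.isRoot_of_mem_roots hν
    obtain ⟨x, hx⟩ := h1.exists_hasEigenvector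
    have hx1 : W x.1 = ν • x.1 := congrArg Subtype.val hx.apply_eq_smul
    have hx0 : x.1 ≠ 0 := fun h => hx.2 (Subtype.ext h)
    have hx2 : W.HasEigenvector ν x.1 := ⟨Module.End.mem_eigenspace_iff.mpr hx1, hx0⟩
    have hν0 := hne ν (Module.End.hasEigenvalue_of_hasEigenvector hx2)
    refine ⟨hν0, ?_⟩
    by_contra hcon
    have hd := (Module.End.independent_maxGenEigenspace W) ν
    have hxU : x.1 ∈ ⨆ (ν') (_ : ν' ≠ ν), W.maxGenEigenspace ν' := by
      have hle : U ≤ ⨆ (ν') (_ : ν' ≠ ν), W.maxGenEigenspace ν' := by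
        refine iSup_le fun ν' => ?_
        exact le_iSup₂_of_le ν'.1 (fun h => hcon (h ▸ ν'.2.2)) le_rfl
      exact hle x.2
    exact hx0 (Submodule.disjoint_def.mp hd x.1 (Module.End.eigenspace_le_maxGenEigenspace hx2.1) hxU)
  rw [Module.End.det_eq_prod_roots_charpoly_of_splits (IsAlgClosed.splits _), hψ.prod _ fun x hx => (hαeig x hx).1] at hz
  have hcard : (LinearMap.charpoly α).roots.card = Module.finrank F U := by
    rw [← LinearMap.charpoly_natDegree α, ← (Polynomial.splits_iff_card_roots.mp (IsAlgClosed.splits _))]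
  rw [Multiset.map_congr rfl (fun x hx => (hαeig x hx).2), Multiset.map_const', Multiset.sum_replicate, hcard, nsmul_eq_mul] at hz
  have h2 : (Module.finrank F U : ℚ) ≠ 0 := by exact_mod_cast hU.ne'
  rcases mul_eq_zero.mp hz with h | h
  · exact absurd h h2
  · exact h.le

theorem exists_slope {x : F} (hx : x ≠ 0) (h : ∀ n : ℕ, 0 < n → x ^ n ≠ 1) : ∃ ψ : F → ℚ, Slope ψ ∧ ψ x ≠ 0 := by
  classical
  let y : Additive Fˣ := Additive.ofMul (Units.mk0 x hx)
  let f : ℤ →+ Additive Fˣ := zmultiplesHom _ y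
  have hf : Function.Injective f := by
    have : ¬ IsOfFinOrder (Units.mk0 x hx) := by
      rw [isOfFinOrder_iff_pow_eq_one]
      rintro ⟨n, hn, h1⟩
      apply h n hn
      have := congrArg Units.val h1
      simpa using this
    have h2 := injective_zpow_iff_not_isOfFinOrder.mpr this
    intro a b hab
    exact h2 hab
  obtain ⟨g, hg⟩ := (Module.Baer.of_divisible ℚ).extension_property_addMonoidHom f hf (Int.castAddHom ℚ)
  refine ⟨fun z => if hz : z = 0 then 0 else g (Additive.ofMul (Units.mk0 z hz)), ⟨fun a b ha hb => ?_⟩, ?_⟩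
  · simp only [ha, hb, mul_eq_zero, or_self, dite_false]
    rw [← map_add, ← ofMul_mul]
    congr 2
    exact Units.ext rfl
  · simp only [hx, dite_false]
    have := DFunLike.congr_fun hg 1
    simp only [AddMonoidHom.comp_apply, f, zmultiplesHom_apply, one_smul] at this
    change g y ≠ 0
    rw [this]; simp

theorem Obj.w_finite_order [IsAlgClosed F] (p : ℕ) [CharP F p] (hp : 0 < p) (T : A →ₗ[F] A)
    (hT : ∀ x, HopfAlgebra.antipode F (HopfAlgebra.antipode F (T x)) = x)
    (O : Obj F A E) : ∃ n, 0 < n ∧ O.w ^ n = 1 := by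
  classical
  have : Fact p.Prime := ⟨(CharP.char_is_prime_or_zero F p).resolve_right hp.ne'⟩
  set W : Module.End F E := LinearMap.mulLeft F O.w with hW
  obtain ⟨w', hw'⟩ : ∃ w', O.w * w' = 1 := ⟨_, O.w_inv T hT⟩
  have hw := exists_inv_left (F := F) hw'
  have hWinj : Function.Injective W := by
    intro a b hab
    have := congrArg (w' * ·) hab
    simpa [hW, ← mul_assoc, hw] using this
  have hroot : ∀ μ ∈ (LinearMap.charpoly W).roots, ∃ n : ℕ, 0 < n ∧ μ ^ n = 1 := by
    intro μ hμ
    have h1 : W.HasEigenvalue μ := by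
      rw [Module.End.hasEigenvalue_iff_isRoot_charpoly]
      exact Polynomial.isRoot_of_mem_roots hμ
    have hne : μ ≠ 0 := by
      rintro rfl
      obtain ⟨x, hx⟩ := h1.exists_hasEigenvector
      exact hx.2 (hWinj (by rw [hx.apply_eq_smul]; simp))
    by_contra! hcon
    obtain ⟨ψ, hψ, hψμ⟩ := exists_slope hne hcon
    have a1 := O.slope_le T hT ψ hψ μ h1
    have a2 := O.slope_le T hT (fun x => - ψ x) ⟨fun x y hx hy => by rw [hψ.mul x y hx hy]; ring⟩ μ h1
    exact hψμ (by linarith)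
  have hN : ∃ N, 0 < N ∧ ∀ μ ∈ (LinearMap.charpoly W).roots, μ ^ N = 1 := by
    generalize (LinearMap.charpoly W).roots = s at hroot
    induction s using Multiset.induction_on with
    | empty => exact ⟨1, one_pos, by simp⟩
    | cons a s ih =>
      obtain ⟨N, hN, h1⟩ := ih fun μ hμ => hroot μ (Multiset.mem_cons_of_mem hμ)
      obtain ⟨n, hn, h2⟩ := hroot a (Multiset.mem_cons_self a s)
      refine ⟨n * N, Nat.mul_pos hn hN, fun μ hμ => ?_⟩
      rcases Multiset.mem_cons.mp hμ with rfl | hμ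
      · rw [pow_mul, h2, one_pow]
      · rw [mul_comm, pow_mul, h1 μ hμ, one_pow]
  obtain ⟨N, hN, hN1⟩ := hN
  have hdvd : LinearMap.charpoly W ∣ (Polynomial.X ^ N - 1) ^ (LinearMap.charpoly W).roots.card := by
    have := (IsAlgClosed.splits (LinearMap.charpoly W)).eq_prod_roots_of_monic (LinearMap.charpoly_monic W)
    conv_lhs => rw [this]
    generalize (LinearMap.charpoly W).roots = s at hN1
    induction s using Multiset.induction_on with
    | empty => simp
    | cons a s ih =>
      rw [Multiset.map_cons, Multiset.prod_cons, Multiset.card_cons, pow_succ']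
      refine mul_dvd_mul ?_ (ih fun μ hμ => hN1 μ (Multiset.mem_cons_of_mem hμ))
      rw [Polynomial.dvd_iff_isRoot]
      simp [hN1 a (Multiset.mem_cons_self a s)]
  set d := (LinearMap.charpoly W).roots.card
  have h1 : (W ^ N - 1) ^ d = 0 := by
    have h := Polynomial.aeval_eq_zero_of_dvd_aeval_eq_zero hdvd (LinearMap.aeval_self_charpoly W)
    simpa using h
  have h2 : (W ^ N - 1) ^ (p ^ d) = 0 := by
    have : d ≤ p ^ d := (Nat.lt_pow_self (Fact.out : p.Prime).one_lt).le
    exact pow_eq_zero_of_le this h1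
  refine ⟨N * p ^ d, Nat.mul_pos hN (pow_pos hp _), ?_⟩
  rcases subsingleton_or_nontrivial E with hE | hE
  · exact Subsingleton.elim _ _
  have : CharP (Module.End F E) p := charP_of_injective_algebraMap (FaithfulSMul.algebraMap_injective F (Module.End F E)) p
  rw [sub_pow_char_pow_of_commute _ _ (Commute.one_right _), one_pow, ← pow_mul, sub_eq_zero] at h2
  have h3 := LinearMap.congr_fun h2 1
  rw [hW, LinearMap.pow_mulLeft] at h3
  simpa using h3
end app
end Xp

namespace Xp
set_option linter.unusedSectionVars false
set_option linter.unusedVariables false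

section five
variable {F A M N : Type*} [Field F] [Ring A] [HopfAlgebra F A] [FiniteDimensional F A]
  [AddCommMonoid M] [Module F M] [AddCommMonoid N] [Module F N]

local notation "S" => HopfAlgebra.antipode F (A := A)
local notation "ε" => Coalgebra.counit (R := F) (A := A)

theorem sw5_left {g : A → A → A → A → A → M} (h1 : ∀ b c d e, Lin F (fun a => g a b c d e))
   (h2 : ∀ a c d e, Lin F (fun b => g a b c d e)) (h3 : ∀ a b d e, Lin F (fun c => g a b c d e))
   (h4 : ∀ a b c e, Lin F (fun d => g a b c d e)) (h5 : ∀ a b c d, Lin F (fun e => g a b c d e)) (h : A) :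
   sw F (fun x y => sw F (fun c z => sw F (fun a b => sw F (fun d e => g a b c d e) z) x) y) h =
   sw F (fun a y => sw F (fun b y => sw F (fun c y => sw F (fun d e => g a b c d e) y) y) y) h := by
  rw [← sw_assoc (f := fun a b y => sw F (fun c y => sw F (fun d e => g a b c d e) y) y)
    ⟨by fun_prop, by fun_prop, by fun_prop⟩]
  exact sw_congr h fun x y => sw_swap _ _

theorem sw5_right {g : A → A → A → A → A → M} (h1 : ∀ b c d e, Lin F (fun a => g a b c d e))
   (h2 : ∀ a c d e, Lin F (fun b => g a b c d e)) (h3 : ∀ a b d e, Lin F (fun c => g a b c d e))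
   (h4 : ∀ a b c e, Lin F (fun d => g a b c d e)) (h5 : ∀ a b c d, Lin F (fun e => g a b c d e)) (h : A) :
   sw F (fun a y => sw F (fun z e => sw F (fun b z => sw F (fun c d => g a b c d e) z) z) y) h =
   sw F (fun a y => sw F (fun b y => sw F (fun c y => sw F (fun d e => g a b c d e) y) y) y) h := by
  refine sw_congr h fun a y => ?_
  rw [sw_assoc (f := fun b z e => sw F (fun c d => g a b c d e) z)
    ⟨by fun_prop, by fun_prop, by fun_prop⟩]
  refine sw_congr y fun b y => ?_
  rw [sw_assoc (f := fun c d e => g a b c d e) ⟨by fun_prop, by fun_prop, by fun_prop⟩]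

theorem sep_left {t s : A ⊗[F] M} (H : ∀ φ : A →ₗ[F] F, TensorProduct.lid F M (LinearMap.rTensor M φ t) =
    TensorProduct.lid F M (LinearMap.rTensor M φ s)) : t = s := by
  have key : ∀ t : A ⊗[F] M, t = ∑ a, (bas F A a) ⊗ₜ[F] TensorProduct.lid F M (LinearMap.rTensor M ((bas F A).coord a) t) := by
    intro t
    induction t with
    | zero => simp
    | add x y hx hy =>
      simp only [map_add, TensorProduct.tmul_add, Finset.sum_add_distrib]
      rw [← hx, ← hy]
    | tmul x y =>
      simp only [LinearMap.rTensor_tmul, TensorProduct.lid_tmul, ← TensorProduct.smul_tmul, ← TensorProduct.sum_tmul]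
      congr 1
      simp [Module.Basis.sum_repr]
  rw [key t, key s]
  simp only [H]

/-- the coaction operator -/
def Ef (φ : A → F) (h x : A) : A ⊗[F] A :=
  sw F (fun a y => sw F (fun b c => sw F (fun u v => φ (a * u * S c) • (b ⊗ₜ[F] v)) x) y) h

theorem Ef_lin {φ : A → F} (hφ : Lin F φ) : Lin2 F (Ef φ) := by
  constructor <;> intro y <;> unfold Ef <;> fun_prop

def Ee (φ : A →ₗ[F] F) : Module.End F (A ⊗[F] A) :=
  TensorProduct.lift (Ef_lin (φ := φ) (by fun_prop)).toLin

theorem Ee_tmul (φ : A →ₗ[F] F) (h x : A) : Ee φ (h ⊗ₜ x) = Ef φ h x := by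
  simp [Ee]

theorem Ee_add (φ ψ : A →ₗ[F] F) : Ee (φ + ψ) = Ee φ + Ee ψ := by
  ext h x
  simp [Ee_tmul, Ef, sw, add_smul, Finset.sum_add_distrib]
theorem Ee_smul (c : F) (φ : A →ₗ[F] F) : Ee (c • φ) = c • Ee φ := by
  ext h x
  simp [Ee_tmul, Ef, sw, mul_smul, Finset.smul_sum]

def EeL : (A →ₗ[F] F) →ₗ[F] Module.End F (A ⊗[F] A) := ⟨⟨Ee, Ee_add⟩, Ee_smul⟩

theorem Ee_sum (φ : A →ₗ[F] F) : ∑ i, φ (bas F A i) • Ee ((bas F A).coord i) = Ee φ := by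
  have : φ = ∑ i, φ (bas F A i) • (bas F A).coord i := by
    refine (bas F A).ext fun j => ?_
    simp
  conv_rhs => rw [this]
  change _ = EeL _
  rw [map_sum]; simp only [map_smul]; rfl

theorem Ee_mul (φ ψ θ : A →ₗ[F] F) (hθ : ∀ a, θ a = sw F (fun x y => φ x * ψ y) a) :
    Ee ψ * Ee φ = Ee θ := by
  ext h x
  simp only [AlgebraTensorModule.curry_apply, LinearMap.restrictScalars_self, curry_apply, Module.End.mul_apply, Ee_tmul]
  let g : A → A → A → A → A → A ⊗[F] A := fun a b c d e =>
    sw F (fun u y => sw F (fun v w => (φ (a * u * S e) * ψ (b * v * S d)) • (c ⊗ₜ[F] w)) y) x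
  have hL : Ef θ h x = sw F (fun x y => sw F (fun c z => sw F (fun a b => sw F (fun d e => g a b c d e) z) x) y) h := by
    unfold Ef
    refine sw_congr h fun a y => sw_congr y fun b c => ?_
    have e1 : ∀ u, θ (a * u * S c) = sw F (fun a1 a2 => sw F (fun d e => sw F (fun u1 u2 => φ (a1 * u1 * S e) * ψ (a2 * u2 * S d)) u) c) a := by
      intro u
      rw [hθ, sw_mul ⟨by fun_prop, by fun_prop⟩, sw_mul ⟨by fun_prop, by fun_prop⟩]
      refine sw_congr a fun a1 a2 => ?_
      rw [sw_swap]
      rw [sw_antipode ⟨by fun_prop, by fun_prop⟩]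
    simp only [e1]
    have e2 : ∀ u v : A, (sw F (fun a1 a2 => sw F (fun d e => sw F (fun u1 u2 => φ (a1 * u1 * S e) * ψ (a2 * u2 * S d)) u) c) a : F) • (b ⊗ₜ[F] v)
        = sw F (fun a1 a2 => sw F (fun d e => sw F (fun u1 u2 => (φ (a1 * u1 * S e) * ψ (a2 * u2 * S d)) • (b ⊗ₜ[F] v)) u) c) a := by
      intro u v
      rw [map_sw (F := F) (fun t => t • (b ⊗ₜ[F] v)) (by fun_prop)]
      refine sw_congr a fun a1 a2 => ?_
      rw [map_sw (F := F) (fun t => t • (b ⊗ₜ[F] v)) (by fun_prop)]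
      refine sw_congr c fun a1 a2 => ?_
      rw [map_sw (F := F) (fun t => t • (b ⊗ₜ[F] v)) (by fun_prop)]
    rw [sw_congr x e2, sw_swap]
    refine sw_congr a fun a1 a2 => ?_
    rw [sw_swap]
    refine sw_congr c fun d e => ?_
    rw [sw_assoc (f := fun u1 u2 v => (φ (a1 * u1 * S e) * ψ (a2 * u2 * S d)) • (b ⊗ₜ[F] v)) ⟨by fun_prop, by fun_prop, by fun_prop⟩]
  have hR : Ee ψ (Ef φ h x) = sw F (fun a y => sw F (fun z e => sw F (fun b z => sw F (fun c d => g a b c d e) z) z) y) h := by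
    unfold Ef
    rw [map_sw (F := F) (fun t => Ee ψ t) (by fun_prop)]
    refine sw_congr h fun a y => ?_
    rw [map_sw (F := F) (fun t => Ee ψ t) (by fun_prop)]
    refine sw_congr y fun z e => ?_
    rw [map_sw (F := F) (fun t => Ee ψ t) (by fun_prop)]
    simp only [map_smul, Ee_tmul, g]
    have e2 : ∀ u v : A, φ (a * u * S e) • Ef ψ z v = sw F (fun b z => sw F (fun c d => sw F (fun v w => 
        (φ (a * u * S e) * ψ (b * v * S d)) • (c ⊗ₜ[F] w)) v) z) z := by
      intro u v
      unfold Ef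
      rw [map_sw (F := F) (fun t => φ (a * u * S e) • t) (by fun_prop)]
      refine sw_congr z fun b c => ?_
      rw [map_sw (F := F) (fun t => φ (a * u * S e) • t) (by fun_prop)]
      refine sw_congr c fun c d => ?_
      rw [map_sw (F := F) (fun t => φ (a * u * S e) • t) (by fun_prop)]
      simp only [mul_smul]
    rw [sw_congr x e2, sw_swap]
    refine sw_congr z fun b z => ?_
    rw [sw_swap]
  rw [hL, hR, sw5_left, sw5_right]
  all_goals
    intros
    dsimp only [g]
    fun_prop

/-- left multiplication on the first factor -/
def piA : A →ₐ[F] Module.End F (A ⊗[F] A) :=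
  AlgHom.ofLinearMap
   ((LinearMap.rTensorHom A) ∘ₗ (LinearMap.mul F A))
   (by ext; simp) (by intro x y; ext a b; simp [mul_assoc])

theorem pi_tmul (h x y : A) : (piA (F := F) h) (x ⊗ₜ y) = (h * x) ⊗ₜ y := by
  simp [piA]

end five
end Xp

namespace Xp
set_option linter.unusedSectionVars false
set_option linter.unusedVariables false

section obj
variable {F A M N : Type*} [Field F] [Ring A] [HopfAlgebra F A] [FiniteDimensional F A]
  [AddCommMonoid M] [Module F M] [AddCommMonoid N] [Module F N]

local notation "S" => HopfAlgebra.antipode F (A := A)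
local notation "ε" => Coalgebra.counit (R := F) (A := A)

theorem Ee_counit : Ee ε = 1 := by
  ext h x
  simp only [AlgebraTensorModule.curry_apply, LinearMap.restrictScalars_self, curry_apply, Module.End.one_apply, Ee_tmul]
  unfold Ef
  simp only [Bialgebra.counit_mul, HopfAlgebra.counit_antipode]
  have e1 : ∀ a b c : A, sw F (fun u v => (ε a * ε u * ε c) • (b ⊗ₜ[F] v)) x = ε a • ε c • (b ⊗ₜ[F] x) := by
    intro a b c
    rw [← sw_counit_left (f := fun v => ε a • ε c • (b ⊗ₜ[F] v)) (by fun_prop)]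
    refine sw_congr x fun u v => ?_
    simp only [smul_smul]; congr 1; ring
  simp only [e1]
  have e2 : ∀ a y : A, sw F (fun b c => ε a • ε c • (b ⊗ₜ[F] x)) y = ε a • (y ⊗ₜ[F] x) := by
    intro a y
    rw [← map_sw (F := F) (fun t => ε a • t) (by fun_prop)]
    rw [sw_counit_right (f := fun b => b ⊗ₜ[F] x) (by fun_prop)]
  simp only [e2]
  rw [sw_counit_left (f := fun b => b ⊗ₜ[F] x) (by fun_prop)]

theorem Ee_pi (φ : A →ₗ[F] F) (h : A) :
    sw F (fun x y => piA y * Ee (φ ∘ₗ LinearMap.mulLeft F x)) h = sw F (fun x y => Ee (φ ∘ₗ LinearMap.mulRight F y) * piA x) h := by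
  ext g x
  simp only [AlgebraTensorModule.curry_apply, LinearMap.restrictScalars_self, curry_apply]
  have el : ∀ f : A → A → Module.End F (A ⊗[F] A), (sw F f h) (g ⊗ₜ x) = sw F (fun a b => f a b (g ⊗ₜ x)) h := by
    intro f; simp [sw]
  rw [el, el]
  simp only [Module.End.mul_apply, Ee_tmul, pi_tmul]
  let G : A → A → A → A ⊗[F] A := fun p q r =>
    sw F (fun g1 y => sw F (fun g2 g3 => sw F (fun u v => φ (p * (g1 * u * S g3) * r) • ((q * g2) ⊗ₜ[F] v)) x) y) g
  have hL : ∀ a b : A, piA (F := F) b (Ef (φ ∘ₗ LinearMap.mulLeft F a) g x) = G a b 1 := by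
    intro a b
    unfold Ef
    dsimp only [G]
    rw [map_sw (F := F) (fun t => piA (F := F) b t) (by fun_prop)]
    refine sw_congr g fun g1 y => ?_
    rw [map_sw (F := F) (fun t => piA (F := F) b t) (by fun_prop)]
    refine sw_congr y fun g1 y => ?_
    rw [map_sw (F := F) (fun t => piA (F := F) b t) (by fun_prop)]
    refine sw_congr x fun u v => ?_
    simp [pi_tmul]
  have hR : ∀ a b : A, Ef (φ ∘ₗ LinearMap.mulRight F b) (a * g) x = sw F (fun a1 y => sw F (fun a2 a3 => G a1 a2 (S a3 * b)) y) a := by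
    intro a b
    unfold Ef
    rw [sw_mul ⟨by fun_prop, by fun_prop⟩]
    refine sw_congr a fun a1 y => ?_
    refine (sw_congr g fun g1 z => sw_mul ⟨by fun_prop, by fun_prop⟩ y z).trans ?_
    rw [sw_swap]
    refine sw_congr y fun a2 a3 => sw_congr g fun g1 y => sw_congr y fun g2 g3 => sw_congr x fun u v => ?_
    simp [HopfAlgebra.antipode_mul_antidistrib, mul_assoc]
  simp only [hL, hR]
  have hG1 : ∀ q r, Lin F (fun p => G p q r) := by intros; dsimp only [G]; fun_prop
  have hG2 : ∀ p r, Lin F (fun q => G p q r) := by intros; dsimp only [G]; fun_prop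
  have hG3 : ∀ p q, Lin F (fun r => G p q r) := by intros; dsimp only [G]; fun_prop
  rw [sw_assoc (f := fun a1 y b => sw F (fun a2 a3 => G a1 a2 (S a3 * b)) y) ⟨by fun_prop, by fun_prop, by fun_prop⟩]
  refine sw_congr h fun a1 y => ?_
  rw [sw_assoc (f := fun a2 a3 b => G a1 a2 (S a3 * b)) ⟨by fun_prop, by fun_prop, by fun_prop⟩]
  rw [sw_Sm23 (f := fun a b => G a1 a b) ⟨by fun_prop, by fun_prop⟩]

variable (F A) in
def theObj : Obj F A (Module.End F (A ⊗[F] A)) where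
  ι := Fin (Module.finrank F A)
  fin := inferInstance
  l := bas F A
  e i := Ee ((bas F A).coord i)
  π := piA
  ax1 := by
    refine sep_left fun φ => sep_left fun ψ => ?_
    simp only [sw, map_sum, LinearMap.rTensor_tmul, TensorProduct.lid_tmul, map_smul]
    let θ : A →ₗ[F] F := (show Lin F (fun a => sw F (fun x y => φ x * ψ y) a) by fun_prop).toLin
    have := Ee_mul φ ψ θ (fun a => rfl)
    rw [← Ee_sum φ, ← Ee_sum ψ, ← Ee_sum θ] at this
    rw [Finset.sum_mul_sum, Finset.sum_comm] at this
    simp only [smul_mul_smul_comm] at this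
    refine Eq.trans ?_ (this.symm.trans ?_)
    · refine Finset.sum_congr rfl fun i _ => ?_
      change _ = (sw F (fun x y => φ x * ψ y) (bas F A i)) • _
      simp only [sw, Finset.sum_smul, mul_smul]
    · refine Finset.sum_congr rfl fun i _ => Finset.sum_congr rfl fun j _ => ?_
      rw [smul_smul, mul_comm]
  ax2 := by rw [Ee_sum, Ee_counit]
  ax3 h := by
    refine sep_left fun φ => ?_
    have := Ee_pi φ h
    simp only [← Ee_sum (_ ∘ₗ _)] at this
    simp only [Finset.mul_sum, Finset.sum_mul, ← sw_sum] at this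
    simp only [map_sum]
    refine Eq.trans ?_ (this.trans ?_)
    · refine Finset.sum_congr rfl fun i _ => ?_
      simp [sw]
    · refine Finset.sum_congr rfl fun i _ => ?_
      simp [sw]

theorem ev_theObj (g : A →ₗ[F] A) (h : (theObj F A).ev g = 1) (x : A) : g x = algebraMap F A (ε x) := by
  have h1 := congrArg (fun t => TensorProduct.rid F A (LinearMap.lTensor A ε (t (1 ⊗ₜ x)))) h
  have h2 : ∀ φ : A →ₗ[F] F, TensorProduct.rid F A (LinearMap.lTensor A ε (Ee φ (1 ⊗ₜ x))) = φ x • 1 := by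
    intro φ
    rw [Ee_tmul]
    unfold Ef
    rw [sw_one (f := fun a y => _) ⟨by fun_prop, by fun_prop⟩, sw_one (f := fun a y => _) ⟨by fun_prop, by fun_prop⟩]
    rw [map_sw (F := F) (fun t => TensorProduct.rid F A (LinearMap.lTensor A ε t)) ⟨by simp, by simp⟩]
    simp only [one_mul, HopfAlgebra.antipode_one, mul_one, map_smul, LinearMap.lTensor_tmul, TensorProduct.rid_tmul]
    rw [← sw_counit_right (f := fun t => φ t • (1 : A)) (by fun_prop)]
    refine sw_congr x fun u v => ?_
    rw [smul_smul, smul_smul, mul_comm]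
  have h3 : ∀ (a : A) (t : A ⊗[F] A), TensorProduct.rid F A (LinearMap.lTensor A ε (piA (F := F) a t)) = 
      a * TensorProduct.rid F A (LinearMap.lTensor A ε t) := by
    intro a t
    induction t with
    | zero => simp
    | add x y hx hy => simp only [map_add, hx, hy, mul_add]
    | tmul x y => simp [pi_tmul]
  have h4 : (theObj F A).ev g = ∑ i, piA (g (bas F A i)) * Ee ((bas F A).coord i) := rfl
  simp only [h4, LinearMap.sum_apply, map_sum, Module.End.mul_apply, h3, h2, Module.End.one_apply, LinearMap.lTensor_tmul, TensorProduct.rid_tmul] at h1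
  rw [Algebra.algebraMap_eq_smul_one, ← h1]
  conv_lhs => rw [← (bas F A).sum_repr x, map_sum]
  simp only [map_smul, mul_smul_comm, mul_one, Module.Basis.coord_apply]

theorem piA_inj {x y : A} (h : piA (F := F) x = piA y) : x = y := by
  have h1 := congrArg (fun t => TensorProduct.rid F A (LinearMap.lTensor A ε (t (1 ⊗ₜ 1)))) h
  simpa [pi_tmul] using h1

end obj

theorem stage1 {F : Type*} {A : Type*} [Field F] [Ring A] [HopfAlgebra F A] [FiniteDimensional F A]
   [IsAlgClosed F] (p : ℕ) [CharP F p] (hp : 0 < p) (T : A →ₗ[F] A)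
   (hT : ∀ x, HopfAlgebra.antipode F (HopfAlgebra.antipode F (T x)) = x) :
   ∃ n, 0 < n ∧ (∀ x, ((Obj.Bop F A ^ n) (Algebra.linearMap F A ∘ₗ Coalgebra.counit)) x = algebraMap F A (Coalgebra.counit x))
     ∧ ∀ x : A, ((HopfAlgebra.antipode F (A := A))^[2 * n]) x = x := by
  obtain ⟨n, hn, h⟩ := (theObj F A).w_finite_order p hp T hT
  refine ⟨n, hn, ev_theObj _ ((theObj F A).ev_pow n ▸ h), fun x => ?_⟩
  have : ∀ m, (theObj F A).w ^ m * piA x = piA ((HopfAlgebra.antipode F (A := A))^[2 * m] x) * (theObj F A).w ^ m := by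
    intro m
    induction m with
    | zero => simp
    | succ m ih =>
      rw [pow_succ', mul_assoc, ih, ← mul_assoc]
      have := (theObj F A).w_mul ((HopfAlgebra.antipode F (A := A))^[2 * m] x)
      change _ * piA _ = piA _ * _ at this
      rw [this, mul_assoc, Nat.mul_succ, Function.iterate_succ_apply', Function.iterate_succ_apply']
  have h2 := this n
  rw [h, one_mul, mul_one] at h2
  exact (piA_inj h2).symm
end Xp

namespace Xp
set_option linter.unusedSectionVars false
set_option linter.unusedVariables false

section inj
variable {F A M N : Type*} [Field F] [Ring A] [HopfAlgebra F A] [FiniteDimensional F A]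
  [AddCommMonoid M] [Module F M] [AddCommMonoid N] [Module F N]

local notation "S" => HopfAlgebra.antipode F (A := A)
local notation "ε" => Coalgebra.counit (R := F) (A := A)
local notation "𝔟" => bas F A

theorem coord_sum {f : A → M} (hf : Lin F f) (a : A) : ∑ i, (𝔟).coord i a • f (𝔟 i) = f a := by
  conv_rhs => rw [← (𝔟).sum_repr a, hf.sum]
  simp only [hf.2, Module.Basis.coord_apply]

/-- convolution of functionals -/
def cm (f m : A →ₗ[F] F) : A →ₗ[F] F := (show Lin F (fun a => sw F (fun x y => f x * m y) a) by fun_prop).toLin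

theorem cm_apply (f m : A →ₗ[F] F) (a : A) : cm f m a = sw F (fun x y => f x * m y) a := rfl

theorem cm_assoc (f g m : A →ₗ[F] F) : cm (cm f g) m = cm f (cm g m) := by
  ext a
  simp only [cm_apply]
  have e1 : ∀ x y, sw F (fun x y => f x * g y) x * m y = sw F (fun a b => f a * g b * m y) x := fun x y =>
    map_sw (F := F) (fun t => t * m y) (by fun_prop) _ _
  have e2 : ∀ x y, f x * sw F (fun x y => g x * m y) y = sw F (fun a b => f x * g a * m b) y := fun x y =>
    (map_sw (F := F) (fun t => f x * t) (by fun_prop) _ _).trans (by simp only [mul_assoc])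
  simp only [e1, e2]
  rw [sw_assoc (f := fun a b y => f a * g b * m y) ⟨by fun_prop, by fun_prop, by fun_prop⟩]

abbrev mi (m : A →ₗ[F] F) (i : Fin (Module.finrank F A)) : A →ₗ[F] F := cm ((𝔟).coord i) m

theorem cm_lin (m : A →ₗ[F] F) : Lin F (fun f => cm f m) := by
  constructor
  · intro x y; ext a; simp [cm_apply, sw, add_mul, Finset.sum_add_distrib]
  · intro x y; ext a; simp [cm_apply, sw, Finset.mul_sum, mul_assoc]

theorem mi_sum (m f : A →ₗ[F] F) : ∑ i, f (𝔟 i) • mi m i = cm f m := by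
  have : f = ∑ i, f (𝔟 i) • (𝔟).coord i := by
    refine (𝔟).ext fun j => ?_
    simp
  conv_rhs => rw [this]
  rw [(cm_lin m).sum]
  simp only [(cm_lin m).2]

theorem mi_counit (m : A →ₗ[F] F) : ∑ i, ε (𝔟 i) • mi m i = m := by
  rw [mi_sum]; ext a
  rw [cm_apply]
  exact sw_counit_left (f := m) (by fun_prop) a

theorem mi_mi {f : (A →ₗ[F] F) → A → A → M} (hf : Lin3 F f) (m : A →ₗ[F] F) :
    ∑ i, ∑ j, f (mi (mi m i) j) (𝔟 j) (𝔟 i) = ∑ i, sw F (fun x y => f (mi m i) x y) (𝔟 i) := by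
  obtain ⟨h1, h2, h3⟩ := hf
  have e0 : ∀ i j, mi (mi m i) j = ∑ l, sw F (fun x y => (𝔟).coord j x * (𝔟).coord i y) (𝔟 l) • mi m l := by
    intro i j
    exact (cm_assoc _ _ _).symm.trans (mi_sum m (cm _ _)).symm
  have e1 : ∀ i j, f (mi (mi m i) j) (𝔟 j) (𝔟 i) = 
      ∑ l, sw F (fun x y => (𝔟).coord j x • (𝔟).coord i y • f (mi m l) (𝔟 j) (𝔟 i)) (𝔟 l) := by
    intro i j
    rw [e0, (h1 _ _).sum]
    refine Finset.sum_congr rfl fun l _ => ?_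
    refine ((h1 _ _).2 _ _).trans ?_
    exact (map_sw (F := F) (fun t => t • f (mi m l) (𝔟 j) (𝔟 i)) (by fun_prop) _ _).trans (by simp only [mul_smul])
  simp only [e1]
  conv_lhs => enter [2, i]; rw [Finset.sum_comm]
  rw [Finset.sum_comm]
  refine Finset.sum_congr rfl fun l _ => ?_
  simp only [sw_sum]
  refine sw_congr _ fun x y => ?_
  rw [Finset.sum_comm]
  simp only [← Finset.smul_sum]
  have e2 : ∀ j, ∑ i, (𝔟).coord i y • f (mi m l) (𝔟 j) (𝔟 i) = f (mi m l) (𝔟 j) y := fun j => coord_sum (h3 _ _) y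
  simp only [e2]
  exact coord_sum (h2 _ _) x

theorem cm_act (m f : A →ₗ[F] F) (h x : A) : sw F (fun a b => f a * m (b * S h)) x =
    ∑ i, sw F (fun a b => f (𝔟 i * b) * mi m i (x * S a)) h := by
  rw [sw_sum]
  have e1 : ∀ a b : A, ∑ i, f (𝔟 i * b) * mi m i (x * S a) =
      sw F (fun c d => sw F (fun x1 x2 => f (x1 * (S d * b)) * m (x2 * S c)) x) a := by
    intro a b
    have := mi_sum m (f ∘ₗ LinearMap.mulRight F b)
    have := congrArg (fun t : A →ₗ[F] F => t (x * S a)) this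
    simp only [LinearMap.sum_apply, LinearMap.smul_apply, smul_eq_mul, LinearMap.comp_apply, LinearMap.mulRight_apply] at this
    rw [this, cm_apply]
    simp only [LinearMap.comp_apply, LinearMap.mulRight_apply]
    rw [sw_mul ⟨by fun_prop, by fun_prop⟩, sw_swap, sw_antipode ⟨by fun_prop, by fun_prop⟩]
    simp only [mul_assoc]
  simp only [e1]
  rw [sw_assoc (f := fun c d b => sw F (fun x1 x2 => f (x1 * (S d * b)) * m (x2 * S c)) x) ⟨by fun_prop, by fun_prop, by fun_prop⟩]
  rw [sw_Sm23 (f := fun c d => sw F (fun x1 x2 => f (x1 * d) * m (x2 * S c)) x) ⟨by fun_prop, by fun_prop⟩]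
  simp only [mul_one]

def PP (m : A →ₗ[F] F) : A →ₗ[F] F := (show Lin F (fun x => ∑ i, mi m i (x * S (S (𝔟 i)))) by fun_prop).toLin

theorem PP_apply (m : A →ₗ[F] F) (x : A) : PP m x = ∑ i, mi m i (x * S (S (𝔟 i))) := rfl

theorem PP_int (m f : A →ₗ[F] F) (x : A) : sw F (fun a b => f a * PP m b) x = f 1 * PP m x := by
  simp only [PP_apply, Finset.mul_sum]
  rw [← sw_sum]
  simp only [cm_act]
  have e1 : ∀ i j, sw F (fun a b => f (𝔟 j * b) * mi (mi m i) j (x * S a)) (S (𝔟 i)) = 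
     sw F (fun a b => f (𝔟 j * S a) * mi (mi m i) j (x * S (S b))) (𝔟 i) := by
    intro i j
    rw [sw_antipode ⟨by fun_prop, by fun_prop⟩]
  simp only [e1]
  rw [mi_mi (f := fun μ u v => sw F (fun a b => f (u * S a) * μ (x * S (S b))) v) 
    ⟨by intros; constructor <;> intros <;> simp [sw, mul_add, Finset.sum_add_distrib, Finset.mul_sum, mul_left_comm], by fun_prop, by fun_prop⟩]
  refine Finset.sum_congr rfl fun i _ => ?_
  rw [← sw_assoc (f := fun u a b => f (u * S a) * mi m i (x * S (S b))) ⟨by fun_prop, by fun_prop, by fun_prop⟩]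
  rw [sw_mS12 (f := fun a b => f a * mi m i (x * S (S b))) ⟨by fun_prop, by fun_prop⟩]

theorem PP_rec (m : A →ₗ[F] F) (x : A) : ∑ i, PP (mi m i) (x * S (𝔟 i)) = m x := by
  simp only [PP_apply]
  rw [mi_mi (f := fun μ u v => μ (x * S v * S (S u))) 
    ⟨by intros; constructor <;> intros <;> simp, by fun_prop, by fun_prop⟩]
  have e1 : ∀ i, sw F (fun a b => mi m i (x * S b * S (S a))) (𝔟 i) = ε (𝔟 i) • mi m i x := by
    intro i
    have := sw_Sm (F := F) (f := fun t => mi m i (x * S t)) (by fun_prop) (𝔟 i)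
    simp only [HopfAlgebra.antipode_mul_antidistrib, HopfAlgebra.antipode_one, mul_one, ← mul_assoc] at this
    exact this
  simp only [e1]
  exact (by simp : ∑ i, ε (𝔟 i) • mi m i x = (∑ i, ε (𝔟 i) • mi m i) x).trans (by rw [mi_counit])

theorem antipode_eq_zero (h : A) (hh : S h = 0) : h = 0 := by
  obtain ⟨t, ht, x0, hx0⟩ : ∃ t : A →ₗ[F] F, (∀ (f : A →ₗ[F] F) x, sw F (fun a b => f a * t b) x = f 1 * t x) ∧ 
     ∃ x, t x ≠ 0 := by
    by_contra! hcon
    have := PP_rec (F := F) (A := A) ε 1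
    rw [Finset.sum_eq_zero] at this
    · simp at this
    · intro i _
      exact hcon _ (fun f x => PP_int _ f x) _
  have h1 : ∀ (x : A), sw F (fun a b => t (x * S a) • b) h = 0 := by
    intro x
    refine (Module.forall_dual_apply_eq_zero_iff F _).1 fun f => ?_
    rw [map_sw (F := F) (fun t => f t) (by fun_prop)]
    have := cm_act t f h x
    rw [hh] at this
    simp only [mul_zero, map_zero] at this
    rw [sw_sum] at this
    refine Eq.trans (sw_congr h fun a b => ?_) (this.symm.trans (by simp [sw]))
    have e : ∀ i, mi t i = (𝔟).coord i 1 • t := by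
      intro i; ext z; exact ht _ _
    simp only [e, LinearMap.smul_apply, smul_eq_mul, map_smul]
    have := coord_sum (F := F) (f := fun u => f (u * b) * t (x * S a)) (by fun_prop) 1
    rw [one_mul] at this
    rw [mul_comm, ← this]
    refine Finset.sum_congr rfl fun i _ => ?_
    rw [smul_eq_mul]; ring
  have h2 : sw F (fun a y => sw F (fun b c => t (x0 * S (a * S b)) • c) y) h = 0 := by
    have e1 : ∀ a b c : A, t (x0 * S (a * S b)) • c = ∑ j, (𝔟).coord j b • (t (x0 * S (S (𝔟 j)) * S a) • c) := by
      intro a b c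
      rw [coord_sum (f := fun b => t (x0 * S (S b) * S a) • c) (by fun_prop), HopfAlgebra.antipode_mul_antidistrib, mul_assoc]
    simp only [e1, ← sw_sum]
    refine Finset.sum_eq_zero fun j _ => ?_
    have := congrArg (fun z => sw F (fun b c => (𝔟).coord j b • c) z) (h1 (x0 * S (S (𝔟 j))))
    rw [map_sw (F := F) (fun z => sw F (fun b c => (𝔟).coord j b • c) z) (by fun_prop)] at this
    refine Eq.trans (sw_congr h fun a y => ?_) (this.trans (by simp [sw]))
    refine Eq.trans ?_ ((show Lin F (fun z => sw F (fun b c => (𝔟).coord j b • c) z) by fun_prop).2 _ _).symm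
    rw [map_sw (F := F) (fun z => t (x0 * S (S (𝔟 j)) * S a) • z) (by fun_prop)]
    exact sw_congr y fun b c => smul_comm _ _ _
  rw [← sw_assoc (f := fun a b c => t (x0 * S (a * S b)) • c) ⟨by fun_prop, by fun_prop, by fun_prop⟩,
    sw_mS12 (f := fun a c => t (x0 * S a) • c) ⟨by fun_prop, by fun_prop⟩] at h2
  simpa [hx0] using h2

theorem exists_T : ∃ T : A →ₗ[F] A, ∀ x, S (S (T x)) = x := by
  have hinj : Function.Injective S := by
    rw [injective_iff_map_eq_zero]; exact antipode_eq_zero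
  have hinj2 : Function.Injective (S ∘ₗ S) := by simpa using hinj.comp hinj
  have := LinearMap.range_eq_top.2 (LinearMap.injective_iff_surjective.1 hinj2)
  obtain ⟨T, hT⟩ := LinearMap.exists_rightInverse_of_surjective _ this
  exact ⟨T, fun x => congrArg (fun g : A →ₗ[F] A => g x) hT⟩

end inj
end Xp

namespace Xp
set_option linter.unusedSectionVars false
set_option linter.unusedVariables false

/-- a group acting by Hopf algebra automorphisms -/
class HopfAct (F A G : Type*) [Field F] [Ring A] [HopfAlgebra F A] [FiniteDimensional F A] [Group G]
    [MulSemiringAction G A] : Prop where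
  counit_smul : ∀ (g : G) (a : A), Coalgebra.counit (R := F) (g • a) = Coalgebra.counit (R := F) a
  comul_smul : ∀ (g : G) (a : A), Coalgebra.comul (R := F) (g • a) = sw F (fun x y => (g • x) ⊗ₜ[F] (g • y)) a
  antipode_smul : ∀ (g : G) (a : A), HopfAlgebra.antipode F (g • a) = g • HopfAlgebra.antipode F a

namespace Sk
open SkewMonoidAlgebra
variable {F A G M : Type*} [Field F] [Ring A] [HopfAlgebra F A] [FiniteDimensional F A] [Group G]
    [MulSemiringAction G A] [SMulCommClass G F A] [AddCommMonoid M] [Module F M]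

local notation "S" => HopfAlgebra.antipode F (A := A)
local notation "ε" => Coalgebra.counit (R := F) (A := A)
local notation "B" => SkewMonoidAlgebra A G

@[fun_prop] theorem Lin_single (g : G) {P : Type*} [AddCommMonoid P] [Module F P] {f : P → A} (hf : Lin F f) :
    Lin F (fun a => (single g (f a) : B)) := by
  refine Lin.comp' (f := fun a => (single g a : B)) ⟨fun x y => single_add _ _ _, fun c x => ?_⟩ hf
  simp [smul_single]

@[fun_prop] theorem Lin_smul (g : G) {P : Type*} [AddCommMonoid P] [Module F P] {f : P → A} (hf : Lin F f) :
    Lin F (fun a => g • (f a)) :=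
  Lin.comp' (f := fun a => g • a) ⟨fun x y => smul_add _ _ _, fun c x => smul_comm _ _ _⟩ hf

variable (F) in
def sg (g : G) : A →ₗ[F] B := (Lin_single (F := F) g Lin.id).toLin

theorem sg_apply (g : G) (a : A) : sg F g a = single g a := rfl

def lft (φ : G → (A →ₗ[F] M)) : B →ₗ[F] M :=
  Finsupp.lsum F φ ∘ₗ (coeffLinearEquiv : B ≃ₗ[F] (G →₀ A)).toLinearMap

@[simp] theorem lft_single (φ : G → (A →ₗ[F] M)) (g : G) (a : A) : lft φ (single g a : B) = φ g a := by
  change Finsupp.lsum F φ (Finsupp.single g a) = _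
  simp

theorem hext {f g : B →ₗ[F] M} (h : ∀ x a, f (single x a) = g (single x a)) : f = g := by
  refine LinearMap.ext fun t => ?_
  induction t using SkewMonoidAlgebra.induction_on with
  | zero => simp
  | single x a => exact h x a
  | add x y hx hy => rw [map_add, map_add, hx, hy]

instance : CoalgebraStruct F B where
  comul := lft fun g => TensorProduct.map (sg F g) (sg F g) ∘ₗ Coalgebra.comul
  counit := lft fun _ => ε

theorem counit_single (g : G) (a : A) : Coalgebra.counit (R := F) (single g a : B) = ε a := lft_single _ _ _
theorem comul_single (g : G) (a : A) : Coalgebra.comul (R := F) (single g a : B) = 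
    sw F (fun x y => (single g x : B) ⊗ₜ[F] (single g y : B)) a := by
  refine (lft_single _ _ _).trans ?_
  rw [LinearMap.comp_apply, comul_eq]
  simp [sw, sg_apply]

instance : Coalgebra F B where
  coassoc := by
    refine hext fun g a => ?_
    simp only [LinearMap.comp_apply, comul_single, LinearEquiv.coe_coe]
    rw [map_sw (F := F) (fun t => (TensorProduct.assoc F B B B) (LinearMap.rTensor B Coalgebra.comul t)) ⟨by simp, by simp⟩,
      map_sw (F := F) (fun t => LinearMap.lTensor B Coalgebra.comul t) ⟨by simp, by simp⟩]
    simp only [LinearMap.rTensor_tmul, LinearMap.lTensor_tmul, comul_single]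
    rw [← sw_congr a fun x y => (map_sw (F := F) (fun t => (single g x : B) ⊗ₜ[F] t) (by fun_prop) _ _).symm]
    rw [← sw_assoc (f := fun x y z => (single g x : B) ⊗ₜ[F] ((single g y : B) ⊗ₜ[F] (single g z : B))) ⟨by fun_prop, by fun_prop, by fun_prop⟩]
    refine sw_congr a fun x y => ?_
    rw [map_sw (F := F) (fun t => (TensorProduct.assoc F B B B) (t ⊗ₜ[F] (single g y : B))) ⟨by simp [TensorProduct.add_tmul], by simp [← TensorProduct.smul_tmul']⟩]
    simp
  rTensor_counit_comp_comul := by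
    refine hext fun g a => ?_
    simp only [LinearMap.comp_apply, comul_single]
    rw [map_sw (F := F) (fun t => LinearMap.rTensor B Coalgebra.counit t) ⟨by simp, by simp⟩]
    simp only [LinearMap.rTensor_tmul, counit_single, TensorProduct.mk_apply]
    rw [← sw_counit_left (f := fun a => (1 : F) ⊗ₜ[F] (single g a : B)) (by fun_prop)]
    refine sw_congr a fun x y => ?_
    rw [TensorProduct.smul_tmul', smul_eq_mul, mul_one]
  lTensor_counit_comp_comul := by
    refine hext fun g a => ?_
    simp only [LinearMap.comp_apply, comul_single]
    rw [map_sw (F := F) (fun t => LinearMap.lTensor B Coalgebra.counit t) ⟨by simp, by simp⟩]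
    simp only [LinearMap.lTensor_tmul, counit_single, TensorProduct.mk_apply, LinearMap.flip_apply]
    rw [← sw_counit_right (f := fun a => (single g a : B) ⊗ₜ[F] (1 : F)) (by fun_prop)]
    refine sw_congr a fun x y => ?_
    rw [← TensorProduct.tmul_smul, smul_eq_mul, mul_one]

theorem sw_smul [HopfAct F A G] (g : G) {f : A → A → M} (hf : Lin2 F f) (a : A) :
    sw F f (g • a) = sw F (fun x y => f (g • x) (g • y)) a := by
  rw [sw_eq_of hf, HopfAct.comul_smul, sw, _root_.map_sum]; rfl

variable [HopfAct F A G]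

instance : Bialgebra F B := Bialgebra.mk' F B
  (by rw [one_def, counit_single, Bialgebra.counit_one])
  (by
    intro a b
    induction a using SkewMonoidAlgebra.induction_on with
    | zero => simp
    | add x y hx hy => simp only [add_mul, map_add, hx, hy]
    | single g a =>
      induction b using SkewMonoidAlgebra.induction_on with
      | zero => simp
      | add x y hx hy => simp only [mul_add, map_add, hx, hy]
      | single h b =>
        rw [single_mul_single, counit_single, counit_single, counit_single, Bialgebra.counit_mul, HopfAct.counit_smul])
  (by
    rw [one_def, comul_single, sw_one ⟨by fun_prop, by fun_prop⟩, Algebra.TensorProduct.one_def, one_def])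
  (by
    intro a b
    induction a using SkewMonoidAlgebra.induction_on with
    | zero => simp
    | add x y hx hy => simp only [add_mul, map_add, hx, hy]
    | single g a =>
      induction b using SkewMonoidAlgebra.induction_on with
      | zero => simp
      | add x y hx hy => simp only [mul_add, map_add, hx, hy]
      | single h b =>
        rw [single_mul_single, comul_single, comul_single, comul_single, sw_mul ⟨by fun_prop, by fun_prop⟩]
        rw [map_sw (F := F) (fun t => t * _) (by fun_prop)]
        refine sw_congr a fun x y => ?_
        rw [sw_smul _ ⟨by fun_prop, by fun_prop⟩]
        rw [map_sw (F := F) (fun t => _ * t) (by fun_prop)]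
        simp [single_mul_single])

instance : HopfAlgebraStruct F B where
  antipode := lft fun g => (show Lin F (fun a => (single g⁻¹ (g⁻¹ • S a) : B)) by fun_prop).toLin

theorem antipode_single (g : G) (a : A) : HopfAlgebra.antipode F (single g a : B) = single g⁻¹ (g⁻¹ • S a) := 
  lft_single _ _ _

instance : HopfAlgebra F B where
  mul_antipode_rTensor_comul := by
    refine hext fun g a => ?_
    simp only [LinearMap.comp_apply, comul_single]
    rw [map_sw (F := F) (fun t => LinearMap.mul' F B (LinearMap.rTensor B (HopfAlgebra.antipode F) t)) ⟨by simp, by simp⟩]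
    simp only [LinearMap.rTensor_tmul, antipode_single, LinearMap.mul'_apply, single_mul_single, ← smul_mul', inv_mul_cancel]
    rw [sw_Sm (F := F) (f := fun t => (single 1 (g⁻¹ • t) : B)) (by fun_prop)]
    rw [counit_single, Algebra.linearMap_apply, Algebra.algebraMap_eq_smul_one, smul_one, one_def]
  mul_antipode_lTensor_comul := by
    refine hext fun g a => ?_
    simp only [LinearMap.comp_apply, comul_single]
    rw [map_sw (F := F) (fun t => LinearMap.mul' F B (LinearMap.lTensor B (HopfAlgebra.antipode F) t)) ⟨by simp, by simp⟩]
    simp only [LinearMap.lTensor_tmul, antipode_single, LinearMap.mul'_apply, single_mul_single, smul_inv_smul, mul_inv_cancel]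
    rw [sw_mS (F := F) (f := fun t => (single 1 t : B)) (by fun_prop)]
    rw [counit_single, Algebra.linearMap_apply, Algebra.algebraMap_eq_smul_one, one_def]

instance [Finite G] : FiniteDimensional F B :=
  Module.Finite.equiv (coeffLinearEquiv : B ≃ₗ[F] (G →₀ A)).symm

theorem antipode_sq (g : G) (a : A) : HopfAlgebra.antipode F (HopfAlgebra.antipode F (single g a : B)) = single g (S (S a)) := by
  rw [antipode_single, antipode_single, inv_inv, HopfAct.antipode_smul, smul_inv_smul]

theorem sw_single [Finite G] {f : B → B → M} (hf : Lin2 F f) (g : G) (a : A) : 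
    sw F f (single g a : B) = sw F (fun x y => f (single g x) (single g y)) a := by
  rw [sw_eq_of hf, comul_single, sw, _root_.map_sum]; rfl

variable (F A) in
def rr : ℕ → A →ₗ[F] A
  | 0 => Algebra.linearMap F A ∘ₗ Coalgebra.counit
  | n + 1 => (show Lin F (fun h => sw F (fun x y => rr n x * S y) h) by fun_prop).toLin

theorem rr_succ (n : ℕ) (h : A) : rr F A (n+1) h = sw F (fun x y => rr F A n x * S y) h := rfl

theorem rr_one (n : ℕ) : rr F A n 1 = 1 := by
  induction n with
  | zero => simp [rr]
  | succ n ih => rw [rr_succ, sw_one ⟨by fun_prop, by fun_prop⟩, ih]; simp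

theorem Bop_single [Finite G] (τ : G) (hτ : ∀ a : A, τ • a = S (S a)) (n : ℕ) (h : A) : 
   ((Obj.Bop F B ^ n) (Algebra.linearMap F B ∘ₗ Coalgebra.counit)) (single τ⁻¹ h) = single (τ ^ n) (τ ^ n • rr F A n h) := by
  induction n generalizing h with
  | zero => 
    simp only [pow_zero, Module.End.one_apply, rr, LinearMap.comp_apply, counit_single, Algebra.linearMap_apply, Algebra.algebraMap_eq_smul_one, one_smul, one_def]
    rw [smul_single]
  | succ n ih =>
    rw [pow_succ', Module.End.mul_apply, Obj.Bop_apply, sw_single ⟨by fun_prop, by fun_prop⟩]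
    simp only [ih, antipode_sq]
    simp only [antipode_single, single_mul_single, inv_inv]
    rw [rr_succ, map_sw (F := F) (fun t => (single (τ ^ (n + 1)) (τ ^ (n + 1) • t) : B)) (by fun_prop)]
    refine sw_congr h fun x y => ?_
    simp only [← hτ, smul_mul', smul_smul, ← pow_succ, ← pow_succ']

theorem rr_final [Finite G] [IsAlgClosed F] (p : ℕ) [CharP F p] (hp : 0 < p) (τ : G) (hτ : ∀ a : A, τ • a = S (S a)) :
    ∃ n, 0 < n ∧ ∀ h, rr F A n h = algebraMap F A (ε h) := by
  obtain ⟨T, hT⟩ := exists_T (F := F) (A := B)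
  obtain ⟨n, hn, h1, -⟩ := stage1 p hp T hT
  have h2 : ∀ h, (single (τ ^ n) (τ ^ n • rr F A n h) : B) = single 1 (algebraMap F A (ε h)) := by
    intro h
    rw [← Bop_single τ hτ, h1, counit_single, Algebra.algebraMap_eq_smul_one, one_def, smul_single, Algebra.algebraMap_eq_smul_one]
  have : Nontrivial A := ⟨1, 0, fun h => by have := congrArg ε h; simp at this⟩
  have h3 := h2 1
  rw [rr_one, smul_one, Bialgebra.counit_one, map_one, single_left_inj one_ne_zero] at h3
  refine ⟨n, hn, fun h => ?_⟩
  have := h2 h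
  rw [h3, one_smul] at this
  exact single_injective _ this
end Sk
end Xp

namespace Xp
set_option linter.unusedSectionVars false
set_option linter.unusedVariables false

section eight
variable {F A : Type*} [Field F] [Ring A] [HopfAlgebra F A] [FiniteDimensional F A]

local notation "S" => HopfAlgebra.antipode F (A := A)
local notation "ε" => Coalgebra.counit (R := F) (A := A)

theorem sw_map (f g : A →ₗ[F] A) (a : A) :
    TensorProduct.map f g (Coalgebra.comul (R := F) a) = sw F (fun x y => f x ⊗ₜ[F] g y) a := by
  rw [← sw_tmul, map_sw (F := F) (fun t => TensorProduct.map f g t) ⟨by simp, by simp⟩]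
  rfl

variable (F A) in
/-- Hopf algebra automorphisms -/
def hopfAut : Subgroup (A ≃ₐ[F] A) where
  carrier := {f | (∀ a, ε (f a) = ε a) ∧
    (∀ a, Coalgebra.comul (R := F) (f a) = TensorProduct.map f.toLinearMap f.toLinearMap (Coalgebra.comul (R := F) a)) ∧
    ∀ a, S (f a) = f (S a)}
  one_mem' := by
    refine ⟨fun a => rfl, fun a => ?_, fun a => rfl⟩
    change _ = TensorProduct.map (LinearMap.id) (LinearMap.id) _
    rw [TensorProduct.map_id]; rfl
  mul_mem' := by
    rintro f g ⟨h1, h2, h3⟩ ⟨g1, g2, g3⟩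
    refine ⟨fun a => ?_, fun a => ?_, fun a => ?_⟩
    · rw [AlgEquiv.mul_apply, h1, g1]
    · rw [AlgEquiv.mul_apply, h2, g2]
      change _ = TensorProduct.map (f.toLinearMap ∘ₗ g.toLinearMap) (f.toLinearMap ∘ₗ g.toLinearMap) _
      rw [TensorProduct.map_comp]; rfl
    · rw [AlgEquiv.mul_apply, h3, g3]; rfl
  inv_mem' := by
    rintro f ⟨h1, h2, h3⟩
    have hf : ∀ a, f (f⁻¹ a) = a := fun a => f.apply_symm_apply a
    have hf' : ∀ a, f⁻¹ (f a) = a := fun a => f.symm_apply_apply a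
    refine ⟨fun a => ?_, fun a => ?_, fun a => ?_⟩
    · rw [← h1, hf]
    · have := h2 (f⁻¹ a)
      rw [hf] at this
      rw [this, ← LinearMap.comp_apply, ← TensorProduct.map_comp]
      have e : (f⁻¹).toLinearMap ∘ₗ f.toLinearMap = LinearMap.id := LinearMap.ext hf'
      rw [e, TensorProduct.map_id]; rfl
    · have := h3 (f⁻¹ a)
      rw [hf] at this
      rw [this, hf']

instance (G : Subgroup (hopfAut F A)) : HopfAct F A G where
  counit_smul g a := g.1.2.1 a
  comul_smul g a := (g.1.2.2.1 a).trans (sw_map _ _ a)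
  antipode_smul g a := g.1.2.2.2 a

variable (F A) in
def sqHom : A →ₐ[F] A := AlgHom.ofLinearMap (S ∘ₗ S) (by simp) (fun x y => by
  simp [HopfAlgebra.antipode_mul_antidistrib])

theorem sqHom_apply (a : A) : sqHom F A a = S (S a) := rfl

theorem sqHom_bij : Function.Bijective (sqHom F A) := by
  have h2 : Function.Surjective (sqHom F A).toLinearMap := by
    obtain ⟨T, hT⟩ := exists_T (F := F) (A := A)
    exact fun x => ⟨T x, hT x⟩
  exact ⟨LinearMap.injective_iff_surjective.2 h2, h2⟩

variable (F A) in
def tau : hopfAut F A := ⟨AlgEquiv.ofBijective (sqHom F A) sqHom_bij, by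
  refine ⟨fun a => ?_, fun a => ?_, fun a => rfl⟩
  · change ε (S (S a)) = _
    simp
  · change Coalgebra.comul (R := F) (S (S a)) = TensorProduct.map (S ∘ₗ S) (S ∘ₗ S) _
    rw [sw_map, ← sw_tmul, sw_antipode ⟨by fun_prop, by fun_prop⟩, sw_antipode ⟨by fun_prop, by fun_prop⟩]
    rfl⟩

theorem tau_apply (a : A) : (tau F A).1 a = S (S a) := rfl

theorem tau_pow (n : ℕ) (a : A) : ((tau F A) ^ n).1 a = (S)^[2*n] a := by
  induction n generalizing a with
  | zero => rfl
  | succ n ih =>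
    rw [pow_succ]
    change ((tau F A) ^ n).1 ((tau F A).1 a) = _
    rw [ih, tau_apply, Nat.mul_succ, Function.iterate_add_apply]; rfl

theorem rr_pow (n : ℕ) : WithConv.toConv (Sk.rr F A n) = (WithConv.toConv (S)) ^ n := by
  induction n with
  | zero => rfl
  | succ n ih =>
    rw [pow_succ, ← ih]
    ext h
    rw [conv_sw]; rfl

theorem sweedler_pow' (n : ℕ) : WithConv.toConv (sweedlerPow F A n) = (WithConv.toConv (LinearMap.id : A →ₗ[F] A)) ^ n := by
  induction n with
  | zero => rfl
  | succ n ih =>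
    rw [pow_succ', ← ih]; rfl

theorem closed_case [IsAlgClosed F] (p : ℕ) [CharP F p] (hp : 0 < p) :
    ∃ n, 0 < n ∧ sweedlerPow F A n = convOne F A := by
  obtain ⟨T, hT⟩ := exists_T (F := F) (A := A)
  obtain ⟨N, hN, -, hS⟩ := stage1 p hp T hT
  have hfin : IsOfFinOrder (tau F A) := isOfFinOrder_iff_pow_eq_one.2 ⟨N, hN, by
    ext a; rw [tau_pow, hS]; rfl⟩
  have : Finite (Subgroup.zpowers (tau F A)) := hfin.finite_zpowers
  obtain ⟨n, hn, h⟩ := Sk.rr_final (F := F) (A := A) (G := Subgroup.zpowers (tau F A)) p hp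
    ⟨tau F A, Subgroup.mem_zpowers _⟩ (fun a => rfl)
  refine ⟨n, hn, ?_⟩
  have h1 : (WithConv.toConv (S)) ^ n = 1 := by
    rw [← rr_pow]; ext a; exact h a
  have h2 : (WithConv.toConv (LinearMap.id : A →ₗ[F] A)) ^ n = 1 := by
    have hc : Commute (WithConv.toConv (S)) (WithConv.toConv (LinearMap.id : A →ₗ[F] A)) := by
      rw [Commute, SemiconjBy, LinearMap.antipode_mul_id, LinearMap.id_mul_antipode]
    have := hc.mul_pow n
    rw [LinearMap.antipode_mul_id, h1, one_pow, one_mul] at this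
    exact this.symm
  rw [← sweedler_pow'] at h2
  exact WithConv.toConv_injective h2
end eight

theorem sweedler_bc (k K H : Type*) [Field k] [Field K] [Algebra k K] [Ring H] [HopfAlgebra k H] (n : ℕ) (h : H) :
    sweedlerPow K (K ⊗[k] H) n (1 ⊗ₜ h) = 1 ⊗ₜ sweedlerPow k H n h := by
  induction n generalizing h with
  | zero =>
    change algebraMap K (K ⊗[k] H) (Coalgebra.counit (R := K) (1 ⊗ₜ[k] h)) = 1 ⊗ₜ algebraMap k H (Coalgebra.counit (R := k) h)
    rw [TensorProduct.counit_tmul, Algebra.algebraMap_eq_smul_one, Algebra.algebraMap_eq_smul_one,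
      Algebra.TensorProduct.one_def, ← TensorProduct.smul_tmul, TensorProduct.smul_tmul']
    simp
  | succ n ih =>
    change LinearMap.mul' K (K ⊗[k] H) (TensorProduct.map LinearMap.id (sweedlerPow K (K ⊗[k] H) n)
      (Coalgebra.comul (R := K) (1 ⊗ₜ[k] h))) = 1 ⊗ₜ LinearMap.mul' k H (TensorProduct.map LinearMap.id (sweedlerPow k H n)
      (Coalgebra.comul (R := k) h))
    rw [TensorProduct.comul_tmul, CommSemiring.comul_apply]
    generalize Coalgebra.comul (R := k) h = t
    induction t using TensorProduct.induction_on with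
    | zero => simp
    | tmul x y => simp [ih]
    | add x y hx hy => simp only [TensorProduct.tmul_add, map_add, hx, hy]

theorem main (k H : Type*) [Field k] [Ring H] [HopfAlgebra k H] [FiniteDimensional k H]
    (p : ℕ) [CharP k p] (hp : 0 < p) : ∃ n, 0 < n ∧ sweedlerPow k H n = convOne k H := by
  have : CharP (AlgebraicClosure k) p :=
    charP_of_injective_algebraMap (algebraMap k (AlgebraicClosure k)).injective p
  obtain ⟨n, hn, h⟩ := closed_case (F := AlgebraicClosure k) (A := AlgebraicClosure k ⊗[k] H) p hp
  refine ⟨n, hn, LinearMap.ext fun x => ?_⟩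
  have h1 := sweedler_bc k (AlgebraicClosure k) H n x
  have h0 := sweedler_bc k (AlgebraicClosure k) H 0 x
  rw [h] at h1
  have h2 := h1.symm.trans h0
  exact Algebra.TensorProduct.includeRight_injective (R := k) (A := AlgebraicClosure k) (B := H)
    (algebraMap k (AlgebraicClosure k)).injective h2

end Xp

/-- a finite-dimensional Hopf algebra over a field of positive characteristic
has finite `exp₀`. -/
theorem stmt16 (k H : Type*) [Field k] [Ring H] [HopfAlgebra k H] [FiniteDimensional k H]
    (p : ℕ) [CharP k p] (hp : 0 < p) :
    exp0 k H ≠ ⊤ := by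
  obtain ⟨n, hn, h⟩ := Xp.main k H p hp
  exact ne_top_of_le_ne_top (ENat.natCast_ne_top n) (sInf_le ⟨n, rfl, hn, h⟩)
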